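/- arXiv:2004.03026 — 6 statements merged into one kernel-verified Lean document; each statement's English description precedes it below -/
import Mathlib

section
/- Let F be a finite field of characteristic 3 and G = T_{3m} with m = 3k+1. Then J(FG) = Ann_{FG}(s), where s is the sum of all 3-elements of G including the identity. -/
/-- Relations of the presentation `T_{3m} = ⟨x, y | x^m = y^3 = 1, y⁻¹xy = x^t⟩`. -/
def T3mRels (m t : ℕ) : Set (FreeGroup (Fin 2)) :=
  {FreeGroup.of 0 ^ m, FreeGroup.of 1 ^ 3,
   (FreeGroup.of 1)⁻¹ * FreeGroup.of 0 * FreeGroup.of 1 * (FreeGroup.of 0 ^ t)⁻¹}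

/-- The group `T_{3m}` given by the presentation `⟨x, y | x^m = y^3 = 1, y⁻¹xy = x^t⟩`. -/
abbrev T3m (m t : ℕ) : Type := PresentedGroup (T3mRels m t)

/-- The generator `x` of `T_{3m}`. -/
def xg (m t : ℕ) : T3m m t := PresentedGroup.of 0

/-- The generator `y` of `T_{3m}`. -/
def yg (m t : ℕ) : T3m m t := PresentedGroup.of 1

namespace T3mAux

variable {F A : Type*} [Field F] [Ring A] [Algebra F A]

/-- powers of `x` indexed by `ZMod m` -/
def X (m : ℕ) (x : A) (i : ZMod m) : A := x ^ i.val

lemma X_nat {m : ℕ} {x : A} (hx : x ^ m = 1) (n : ℕ) : X m x (n : ZMod m) = x ^ n := by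
  unfold X
  rw [ZMod.val_natCast, ← pow_eq_pow_mod n hx]

lemma X_add {m : ℕ} [NeZero m] {x : A} (hx : x ^ m = 1) (i j : ZMod m) :
    X m x (i + j) = X m x i * X m x j := by
  have h := X_nat hx (i.val + j.val)
  rw [pow_add] at h
  push_cast at h
  rwa [ZMod.natCast_zmod_val, ZMod.natCast_zmod_val] at h

lemma X_zero {m : ℕ} {x : A} (hx : x ^ m = 1) : X m x 0 = 1 := by
  have := X_nat hx 0
  simpa using this

lemma X_one {m : ℕ} {x : A} (hx : x ^ m = 1) : X m x 1 = x := by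
  have := X_nat hx 1
  simpa using this

lemma X_y {m t : ℕ} [NeZero m] {x y : A} (hx : x ^ m = 1) (hxy : x * y = y * x ^ t)
    (i : ZMod m) : X m x i * y = y * X m x (t * i) := by
  have h : ∀ n : ℕ, x ^ n * y = y * x ^ (t * n) := by
    intro n
    induction n with
    | zero => simp
    | succ n ih => rw [pow_succ, mul_assoc, hxy, ← mul_assoc, ih, mul_assoc, ← pow_add]; rfl
  have h2 := h i.val
  rw [← X_nat hx (t * i.val)] at h2
  push_cast at h2
  rwa [ZMod.natCast_zmod_val] at h2

/-- multiplication by `t` -/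
def tEquiv {m : ℕ} (τ : ZMod m) (h : τ ^ 3 = 1) : ZMod m ≃ ZMod m where
  toFun i := τ * i
  invFun i := τ ^ 2 * i
  left_inv i := by
    show τ ^ 2 * (τ * i) = i
    linear_combination i * h
  right_inv i := by
    show τ * (τ ^ 2 * i) = i
    linear_combination i * h

lemma exists_c (F : Type*) [Field F] {m : ℕ} [NeZero m] (τ : ZMod m) (h : τ ^ 3 = 1)
    (h1 : ∀ i : ZMod m, τ * i = i → i = 0) :
    ∃ c : ZMod m → F, ∀ i, c i + c (τ * i) + c (τ ^ 2 * i) = if i = 0 then 0 else -1 := by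
  refine ⟨fun i => if i.val < (τ * i).val ∧ i.val < (τ ^ 2 * i).val then -1 else 0, fun i => ?_⟩
  have e1 : τ * (τ * i) = τ ^ 2 * i := by ring
  have e2 : τ ^ 2 * (τ * i) = i := by linear_combination i * h
  have e3 : τ * (τ ^ 2 * i) = i := by linear_combination i * h
  have e4 : τ ^ 2 * (τ ^ 2 * i) = τ * i := by linear_combination τ * i * h
  simp only [e1, e2, e3, e4]
  by_cases hi : i = 0
  · simp [hi]
  · have n1 : (τ * i).val ≠ i.val := fun hh => hi (h1 i (ZMod.val_injective m hh))
    have n2 : (τ ^ 2 * i).val ≠ (τ * i).val := fun hh => by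
      have := h1 (τ * i) (e1.trans (ZMod.val_injective m hh))
      apply hi
      rw [← e2, this, mul_zero]
    have n3 : (τ ^ 2 * i).val ≠ i.val := fun hh => by
      have hh := ZMod.val_injective m hh
      apply hi (h1 i _)
      rw [← hh, e3, hh]
    simp only [hi, if_false]
    generalize (τ * i).val = a at *
    generalize (τ ^ 2 * i).val = b at *
    generalize i.val = d at *
    split_ifs <;> first | (exfalso; omega) | simp

/-- the averaged projection commuting with `x` -/
noncomputable def psi (m : ℕ) [NeZero m] (x : A) (π : A →ₗ[F] A) : A →ₗ[F] A :=
  ∑ i : ZMod m, LinearMap.mulLeft F (X m x i) ∘ₗ π ∘ₗ LinearMap.mulLeft F (X m x (-i))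

lemma psi_apply (m : ℕ) [NeZero m] (x : A) (π : A →ₗ[F] A) (w : A) :
    psi m x π w = ∑ i : ZMod m, X m x i * π (X m x (-i) * w) := by
  simp [psi]

lemma psi_X {m : ℕ} [NeZero m] {x : A} (hx : x ^ m = 1) (π : A →ₗ[F] A) (j : ZMod m) (w : A) :
    psi m x π (X m x j * w) = X m x j * psi m x π w := by
  rw [psi_apply, psi_apply, Finset.mul_sum, ← Equiv.sum_comp (Equiv.addLeft j)]
  refine Finset.sum_congr rfl fun i _ => ?_
  simp only [Equiv.coe_addLeft]
  have h : -(j + i) + j = -i := by ring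
  rw [← mul_assoc (X m x (-(j+i))), ← X_add hx, X_add hx j i, mul_assoc, h]

lemma main (m t : ℕ) [NeZero m] (hm1 : (m : F) = 1) (h3 : (3 : F) = 0)
    (ht : (t : ZMod m) ^ 3 = 1)
    (hfix : ∀ i : ZMod m, t * i = i → i = 0) (x y : A) (hx : x ^ m = 1) (hy : y ^ 3 = 1)
    (hxy : x * y = y * x ^ t) (hgen : Algebra.adjoin F {x, y} = ⊤)
    (ε : A →ₐ[F] F) (hεx : ε x = 1) (hεy : ε y = 1)
    (e : A) (he : e = ∑ i : ZMod m, X m x i) (hne : e * (1 + y + y ^ 2) ≠ 0) (α : A) :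
    α ∈ (⊥ : Ideal A).jacobson ↔
      (α * (e * y ^ 2 + 1 + e * y) = 0 ∧ (e * y ^ 2 + 1 + e * y) * α = 0) := by
  have ind : ∀ {P : A → Prop}, P x → P y → (∀ r : F, P (algebraMap F A r)) →
      (∀ a b, P a → P b → P (a + b)) → (∀ a b, P a → P b → P (a * b)) → ∀ a, P a := by
    intro P h1 h2 h3 h4 h5 a
    have ha : a ∈ Algebra.adjoin F {x, y} := hgen ▸ Algebra.mem_top
    induction ha using Algebra.adjoin_induction with
    | mem a ha => rcases ha with rfl | rfl <;> assumption
    | algebraMap r => exact h3 r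
    | add a b _ _ ha hb => exact h4 a b ha hb
    | mul a b _ _ ha hb => exact h5 a b ha hb
  have h3A : (3 : A) = 0 := by
    have := congrArg (algebraMap F A) h3
    rwa [map_ofNat, map_zero] at this
  have hy' : y * (y * y) = 1 := by rw [← hy]; noncomm_ring
  have Xe : ∀ j, X m x j * e = e := by
    intro j
    rw [he, Finset.mul_sum]
    simp only [← X_add hx]
    exact Equiv.sum_comp (Equiv.addLeft j) (X m x)
  have eX : ∀ j, e * X m x j = e := by
    intro j
    rw [he, Finset.sum_mul]
    simp only [← X_add hx]
    exact Equiv.sum_comp (Equiv.addRight j) (X m x)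
  have xe : x * e = e := by simpa [X_one hx] using Xe 1
  have ex : e * x = e := by simpa [X_one hx] using eX 1
  have ey : e * y = y * e := by
    rw [he, Finset.sum_mul, Finset.mul_sum]
    simp only [X_y hx hxy]
    exact Equiv.sum_comp (tEquiv _ ht) (fun i => y * X m x i)
  have ee : e * e = e := by
    have h0 : e * e = ∑ i : ZMod m, X m x i * e := by rw [← Finset.sum_mul, ← he]
    rw [h0, Finset.sum_congr rfl fun i _ => Xe i]
    simp only [Finset.sum_const, Finset.card_univ, ZMod.card]
    rw [← Nat.cast_smul_eq_nsmul F, hm1, one_smul]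
  have εX : ∀ i, ε (X m x i) = 1 := fun i => by simp [X, hεx]
  have εe : ε e = 1 := by simp [he, εX, hm1]
  have ecomm : ∀ a, e * a = a * e := by
    refine ind ?_ ey ?_ ?_ ?_
    · rw [ex, xe]
    · intro r; exact (Algebra.commutes r e).symm
    · intro a b ha hb; rw [mul_add, add_mul, ha, hb]
    · intro a b ha hb; rw [← mul_assoc, ha, mul_assoc, hb, mul_assoc]
  have yX : ∀ j, y * X m x j = X m x (t ^ 2 * j) * y := by
    intro j
    rw [X_y hx hxy]
    congr 2
    linear_combination (-j) * ht
  -- the norm element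
  set eh := e * (1 + y + y ^ 2) with heh
  have yeh : y * eh = eh := by
    have : y * eh = y * e + y * e * y + y * e * (y * y) := by rw [heh]; noncomm_ring
    rw [this, ← ey]
    have h2 : e * y * (y * y) = e := by rw [mul_assoc, hy', mul_one]
    rw [h2, heh]; noncomm_ring
  have xeh : x * eh = eh := by rw [heh, ← mul_assoc, xe]
  have aeh : ∀ a, a * eh = ε a • eh := by
    refine ind ?_ ?_ ?_ ?_ ?_
    · rw [hεx, one_smul, xeh]
    · rw [hεy, one_smul, yeh]
    · intro r; rw [AlgHom.commutes, Algebra.smul_def]; rfl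
    · intro a b ha hb; rw [add_mul, ha, hb, map_add, add_smul]
    · intro a b ha hb; rw [mul_assoc, hb, mul_smul_comm, ha, map_mul, smul_smul, mul_comm]
  set s := e * y ^ 2 + 1 + e * y with hs
  have es : e * s = eh := by
    have : e * s = (e * e) * y ^ 2 + e + (e * e) * y := by rw [hs]; noncomm_ring
    rw [this, ee, heh]; noncomm_ring
  have ysy : s * y = y * s := by
    have h1 : e * y ^ 2 * y = y * (e * y ^ 2) := by
      rw [← mul_assoc, ← ey, mul_assoc, mul_assoc, pow_two]; simp only [mul_assoc]
    have h2 : e * y * y = y * (e * y) := by rw [ey, mul_assoc, ey]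
    rw [hs, add_mul, add_mul, mul_add, mul_add, h1, h2, one_mul, mul_one]
  have eyx : e * y * x = e * y := by rw [ey, mul_assoc, ex]
  have sx : s * x = x * s := by
    have h0 : y ^ 2 * e = e * y ^ 2 := (ecomm _).symm
    have h1 : e * y ^ 2 * x = x * (e * y ^ 2) := by
      rw [← mul_assoc, xe, ← h0, mul_assoc, ex]
    have h2 : e * y * x = x * (e * y) := by rw [eyx, ← mul_assoc, xe]
    rw [hs, add_mul, add_mul, mul_add, mul_add, h1, h2, one_mul, mul_one]
  have scomm : ∀ a, s * a = a * s := by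
    refine ind sx ysy ?_ ?_ ?_
    · intro r; exact (Algebra.commutes r s).symm
    · intro a b ha hb; rw [mul_add s, ha, hb, add_mul]
    · intro a b ha hb; rw [← mul_assoc, ha, mul_assoc, hb, mul_assoc]
  rw [scomm, and_self]
  constructor
  · intro hα
    -- α is killed by the augmentation
    have hεα : ε α = 0 := by
      by_contra hc
      obtain ⟨z, hz⟩ := Ideal.mem_jacobson_iff.1 hα (algebraMap F A (-(ε α)⁻¹))
      rw [Ideal.mem_bot] at hz
      have := congrArg ε hz
      simp only [map_sub, map_add, map_mul, AlgHom.commutes, map_one, map_zero] at this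
      rw [Algebra.algebraMap_self, RingHom.id_apply, mul_assoc, neg_mul, inv_mul_cancel₀ hc] at this
      have h1 : (1 : F) = 0 := by linear_combination -this
      exact one_ne_zero h1
    have key : (1 - e) * α = 0 := by
      obtain ⟨c, hc⟩ := exists_c F (t : ZMod m) ht hfix
      set z : A := ∑ i : ZMod m, c i • X m x i with hz
      set J : Submodule F A := ((⊥ : Ideal A).jacobson).restrictScalars F with hJ
      have hJmem : ∀ a, a ∈ J ↔ a ∈ (⊥ : Ideal A).jacobson := fun a => Iff.rfl
      obtain ⟨p, hp⟩ := J.subtype.exists_leftInverse_of_injective J.ker_subtype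
      set π : A →ₗ[F] A := J.subtype ∘ₗ p with hπ
      have πJ : ∀ a, π a ∈ (⊥ : Ideal A).jacobson := fun a => (p a).2
      have πid : ∀ a ∈ (⊥ : Ideal A).jacobson, π a = a := by
        intro a ha
        have := LinearMap.congr_fun hp ⟨a, ha⟩
        simp only [LinearMap.comp_apply, LinearMap.id_apply, Submodule.subtype_apply] at this
        rw [hπ, LinearMap.comp_apply, this]
        rfl
      have zX : ∀ j, z * X m x j = X m x j * z := by
        intro j
        rw [hz, Finset.sum_mul, Finset.mul_sum]
        refine Finset.sum_congr rfl fun i _ => ?_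
        rw [smul_mul_assoc, mul_smul_comm, ← X_add hx, ← X_add hx, add_comm]
      have trz : z + y * z * (y * y) + y * y * z * y = 1 - e := by
        have h1 : y * z * (y * y) = ∑ i : ZMod m, c (t * i) • X m x i := by
          rw [← Equiv.sum_comp (tEquiv _ ht).symm, hz, Finset.mul_sum, Finset.sum_mul]
          refine Finset.sum_congr rfl fun i _ => ?_
          have h1 : (t : ZMod m) * (tEquiv _ ht).symm i = i := (tEquiv _ ht).apply_symm_apply i
          rw [h1, mul_smul_comm, smul_mul_assoc, yX, mul_assoc, hy', mul_one]
          rfl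
        have h2 : y * y * z * y = ∑ i : ZMod m, c (t ^ 2 * i) • X m x i := by
          rw [← Equiv.sum_comp (tEquiv _ ht), hz, Finset.mul_sum, Finset.sum_mul]
          refine Finset.sum_congr rfl fun i _ => ?_
          have h1 : (t : ZMod m) ^ 2 * (tEquiv _ ht) i = i := (tEquiv _ ht).symm_apply_apply i
          rw [h1, mul_smul_comm, smul_mul_assoc, mul_assoc, X_y hx hxy, ← mul_assoc,
            mul_assoc y, hy', one_mul]
          rfl
        rw [h1, h2, hz, ← Finset.sum_add_distrib, ← Finset.sum_add_distrib]
        simp only [← add_smul, hc]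
        have h3 : ∀ i : ZMod m, (if i = 0 then (0 : F) else -1) • X m x i =
            (if i = 0 then X m x i else 0) - X m x i := by
          intro i
          split_ifs <;> simp
        simp only [h3, Finset.sum_sub_distrib, ← he]
        simp [X_zero hx]
      set ψ := psi m x π with hψ
      have ψX : ∀ j w, ψ (X m x j * w) = X m x j * ψ w := psi_X hx π
      have ψJ : ∀ w, ψ w ∈ (⊥ : Ideal A).jacobson := by
        intro w
        rw [hψ, psi_apply]
        exact Ideal.sum_mem _ fun i _ => Ideal.mul_mem_left _ _ (πJ _)
      have ψid : ∀ a ∈ (⊥ : Ideal A).jacobson, ψ a = a := by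
        intro a ha
        rw [hψ, psi_apply]
        have h1 : ∀ i : ZMod m, X m x i * π (X m x (-i) * a) = a := by
          intro i
          rw [πid _ (Ideal.mul_mem_left _ _ ha), ← mul_assoc, ← X_add hx, add_neg_cancel,
            X_zero hx, one_mul]
        simp only [h1, Finset.sum_const, Finset.card_univ, ZMod.card]
        rw [← Nat.cast_smul_eq_nsmul F, hm1, one_smul]
      obtain ⟨φ, hφ⟩ : ∃ φ : A → A, ∀ v, φ v =
          z * ψ v + y * z * ψ (y * y * v) + y * y * z * ψ (y * v) := ⟨_, fun _ => rfl⟩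
      have φJ : ∀ w, φ w ∈ (⊥ : Ideal A).jacobson := by
        intro w
        rw [hφ]
        exact Ideal.add_mem _ (Ideal.add_mem _ (Ideal.mul_mem_left _ _ (ψJ _))
          (Ideal.mul_mem_left _ _ (ψJ _))) (Ideal.mul_mem_left _ _ (ψJ _))
      have φid : ∀ a ∈ (⊥ : Ideal A).jacobson, φ a = (1 - e) * a := by
        intro a ha
        rw [hφ, ψid _ ha, ψid _ (Ideal.mul_mem_left _ _ ha), ψid _ (Ideal.mul_mem_left _ _ ha),
          ← trz]
        noncomm_ring
      have φlin : ∀ a, ∀ v, φ (a * v) = a * φ v := by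
        refine ind ?_ ?_ ?_ ?_ ?_
        · intro v
          have k1 : x = X m x 1 := (X_one hx).symm
          have k2 : y * x = X m x (t ^ 2) * y := by
            have := yX 1
            rwa [X_one hx, mul_one] at this
          have k3 : y * y * x = X m x t * (y * y) := by
            rw [mul_assoc, k2, ← mul_assoc, yX, mul_assoc]
            congr 2
            linear_combination (t : ZMod m) * ht
          have k4 : y * X m x t = x * y := by rw [X_nat hx, hxy]
          have k5 : y * y * X m x (t ^ 2) = x * (y * y) := by
            have := X_y hx hxy (t : ZMod m)
            rw [← pow_two] at this
            rw [mul_assoc, ← this, ← mul_assoc, k4, mul_assoc]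
          have l1 : ψ (x * v) = x * ψ v := by
            have := ψX 1 v
            rwa [X_one hx] at this
          have l2 : ψ (y * y * (x * v)) = X m x t * ψ (y * y * v) := by
            rw [← mul_assoc, k3, mul_assoc, ψX]
          have l3 : ψ (y * (x * v)) = X m x (t ^ 2) * ψ (y * v) := by
            rw [← mul_assoc, k2, mul_assoc, ψX]
          have zx : z * x = x * z := by
            have := zX 1
            rwa [X_one hx] at this
          rw [hφ, hφ, l1, l2, l3, mul_add, mul_add]
          congr 1
          · congr 1
            · rw [← mul_assoc, zx, mul_assoc]
            · rw [← mul_assoc, mul_assoc y, zX, ← mul_assoc, k4]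
              simp only [mul_assoc]
          · rw [← mul_assoc, mul_assoc (y * y), zX, ← mul_assoc, k5]
            simp only [mul_assoc]
        · intro v
          have l1 : y * y * (y * v) = v := by
            rw [← mul_assoc, mul_assoc y, hy', one_mul]
          have l2 : y * (y * y * z * ψ (y * v)) = z * ψ (y * v) := by
            rw [← mul_assoc, ← mul_assoc, hy', one_mul]
          rw [hφ, hφ, mul_add, mul_add, l1, l2]
          simp only [mul_assoc]
          abel
        · intro r v
          simp only [hφ, ← Algebra.smul_def, mul_smul_comm, map_smul, smul_add]
        · intro a b ha hb v
          have hadd : ∀ u w, φ (u + w) = φ u + φ w := by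
            intro u w
            simp only [hφ, mul_add, map_add]
            abel
          rw [add_mul, hadd, ha, hb, add_mul]
        · intro a b ha hb v
          rw [mul_assoc, ha, hb, mul_assoc]
      have hv : (1 - e) * α ∈ (⊥ : Ideal A).jacobson := Ideal.mul_mem_left _ _ hα
      have hvn : (1 - e) * α * φ 1 = (1 - e) * α := by
        rw [← φlin, mul_one, φid _ hv, ← mul_assoc]
        congr 1
        have : (1 - e) * (1 - e) = 1 - e - e + e * e := by noncomm_ring
        rw [this, ee]; noncomm_ring
      generalize (1 - e) * α = v at *
      have hn := φJ 1
      generalize φ 1 = n at *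
      -- `1 - n` is invertible on the right
      obtain ⟨u, hu⟩ := Ideal.mem_jacobson_iff.1 hn (-1)
      rw [Ideal.mem_bot] at hu
      have hu1 : u * (1 - n) = 1 := by
        have : u * (1 - n) = (u * -1 * n + u - 1) + 1 := by noncomm_ring
        rw [this, hu, zero_add]
      obtain ⟨w, hw⟩ := Ideal.mem_jacobson_iff.1 hn u
      rw [Ideal.mem_bot] at hw
      have hw1 : w * u = 1 := by
        have h1 : u = 1 + u * n := by
          have : u - (1 + u * n) = u * (1 - n) - 1 := by noncomm_ring
          rw [hu1, sub_self] at this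
          exact sub_eq_zero.1 this
        have h2 : w * u = (w * u * n + w - 1) + 1 := by
          conv_lhs => rw [h1]
          noncomm_ring
        rw [h2, hw, zero_add]
      have hwn : w = 1 - n := by
        calc w = w * (u * (1 - n)) := by rw [hu1, mul_one]
          _ = 1 - n := by rw [← mul_assoc, hw1, one_mul]
      have hvw : v * w = 0 := by rw [hwn, mul_sub, mul_one, hvn, sub_self]
      calc v = v * w * u := by rw [mul_assoc, hw1, mul_one]
        _ = 0 := by rw [hvw, zero_mul]
    have hα' : α = α * e := by
      rw [← ecomm]
      have : α - e * α = 0 := by rw [← key]; noncomm_ring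
      exact sub_eq_zero.1 this
    rw [hα', mul_assoc, es, aeh, hεα, zero_smul]
  · intro h
    have hα : α * eh = 0 := by rw [← es, ecomm, ← mul_assoc, h, zero_mul]
    have hεα : ε α = 0 := by
      rw [aeh] at hα
      exact (smul_eq_zero.1 hα).resolve_right hne
    have hse : α * e = α := by
      have h1 : (1 - e) * s = 1 - e := by
        have : (1 - e) * s = s - e * s := by noncomm_ring
        rw [this, es, hs, heh]; noncomm_ring
      have h2 : α * (1 - e) = 0 := by
        rw [← h1, ← scomm, ← mul_assoc, h, zero_mul]
      have h3 : α - α * e = 0 := by rw [← h2]; noncomm_ring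
      exact (sub_eq_zero.1 h3).symm
    have nf : ∀ a, ∃ p : Polynomial F, a * e = Polynomial.aeval y p * e := by
      refine ind ⟨1, ?_⟩ ⟨Polynomial.X, ?_⟩ ?_ ?_ ?_
      · simp [xe]
      · simp
      · intro r; exact ⟨Polynomial.C r, by simp⟩
      · rintro a b ⟨p, hp⟩ ⟨q, hq⟩
        exact ⟨p + q, by rw [add_mul, hp, hq, map_add, add_mul]⟩
      · rintro a b ⟨p, hp⟩ ⟨q, hq⟩
        refine ⟨p * q, ?_⟩
        rw [mul_assoc, hq, ← ecomm, ← mul_assoc, hp, mul_assoc, ecomm, map_mul, mul_assoc]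
    have hεp : ∀ p : Polynomial F, ε (Polynomial.aeval y p) = p.eval 1 := by
      intro p
      rw [← Polynomial.aeval_algHom_apply, hεy, Polynomial.coe_aeval_eq_eval]
    have cube : ∀ a, ε a = 0 → (a * e) ^ 3 = 0 := by
      intro a ha
      obtain ⟨p, hp⟩ := nf a
      have hp1 : p.eval 1 = 0 := by
        have := congrArg ε hp
        rw [map_mul, map_mul, εe, ha, hεp] at this
        simpa using this.symm
      obtain ⟨q, hq⟩ := Polynomial.dvd_iff_isRoot.2 hp1
      have hcomm : Commute (Polynomial.aeval y p) e := (ecomm _).symm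
      rw [hp, hcomm.mul_pow, ← map_pow, hq, mul_pow, map_mul]
      have : Polynomial.aeval y ((Polynomial.X - Polynomial.C (1:F)) ^ 3) = 0 := by
        simp only [map_pow, map_sub, Polynomial.aeval_X, map_one]
        have : (y - 1) ^ 3 = y ^ 3 - 1 - 3 * (y ^ 2 - y) := by noncomm_ring
        rw [this, hy, h3A]; simp
      rw [this, zero_mul, zero_mul]
    rw [Ideal.mem_jacobson_iff]
    intro b
    have hb : (b * α) ^ 3 = 0 := by
      have := cube (b * α) (by rw [map_mul, hεα, mul_zero])
      rwa [mul_assoc, hse] at this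
    refine ⟨1 - b * α + (b * α) ^ 2, ?_⟩
    rw [Ideal.mem_bot, mul_assoc]
    generalize b * α = w at *
    have : (1 - w + w ^ 2) * w + (1 - w + w ^ 2) - 1 = w ^ 3 := by noncomm_ring
    rw [this, hb]

end T3mAux

namespace T3mAux

lemma xg_pow (m t : ℕ) : xg m t ^ m = 1 := by
  have : (PresentedGroup.mk (T3mRels m t)) (FreeGroup.of 0 ^ m) = 1 :=
    PresentedGroup.one_of_mem (by simp [T3mRels])
  rw [map_pow] at this
  exact this

lemma yg_pow (m t : ℕ) : yg m t ^ 3 = 1 := by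
  have : (PresentedGroup.mk (T3mRels m t)) (FreeGroup.of 1 ^ 3) = 1 :=
    PresentedGroup.one_of_mem (by simp [T3mRels])
  rw [map_pow] at this
  exact this

lemma xg_yg (m t : ℕ) : xg m t * yg m t = yg m t * xg m t ^ t := by
  have : (PresentedGroup.mk (T3mRels m t)) ((FreeGroup.of 1)⁻¹ * FreeGroup.of 0 * FreeGroup.of 1 *
      (FreeGroup.of 0 ^ t)⁻¹) = 1 :=
    PresentedGroup.one_of_mem (by simp [T3mRels])
  have h2 : (yg m t)⁻¹ * xg m t * yg m t * (xg m t ^ t)⁻¹ = 1 := by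
    simp only [map_mul, map_inv, map_pow] at this
    exact this
  rw [mul_inv_eq_one, mul_assoc, inv_mul_eq_iff_eq_mul] at h2
  exact h2

/-- quotient onto the cyclic group of order 3 -/
def toC3 (m t : ℕ) : T3m m t →* Multiplicative (ZMod 3) :=
  PresentedGroup.toGroup (f := ![1, Multiplicative.ofAdd 1]) (by
    intro r hr
    simp only [T3mRels, Set.mem_insert_iff, Set.mem_singleton_iff] at hr
    rcases hr with rfl | rfl | rfl
    · simp
    · simp; decide
    · simp)

lemma toC3_x (m t : ℕ) : toC3 m t (xg m t) = 1 := by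
  simp [toC3, xg]

lemma toC3_y (m t : ℕ) : toC3 m t (yg m t) = Multiplicative.ofAdd 1 := by
  simp [toC3, yg]

lemma adjoin_top (F : Type*) [Field F] (m t : ℕ) (hm : m ≠ 0) :
    Algebra.adjoin F {MonoidAlgebra.of F (T3m m t) (xg m t), MonoidAlgebra.of F (T3m m t) (yg m t)}
      = ⊤ := by
  set S := Algebra.adjoin F
    {MonoidAlgebra.of F (T3m m t) (xg m t), MonoidAlgebra.of F (T3m m t) (yg m t)} with hS
  have hxS : MonoidAlgebra.of F (T3m m t) (xg m t) ∈ S := Algebra.subset_adjoin (by simp)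
  have hyS : MonoidAlgebra.of F (T3m m t) (yg m t) ∈ S := Algebra.subset_adjoin (by simp)
  have inv_pow : ∀ (g : T3m m t) (n : ℕ), n ≠ 0 → g ^ n = 1 → g⁻¹ = g ^ (n - 1) := by
    intro g n hn h
    rw [inv_eq_iff_mul_eq_one, ← pow_succ', Nat.sub_add_cancel (Nat.pos_of_ne_zero hn), h]
  have hg : ∀ g : T3m m t, MonoidAlgebra.of F (T3m m t) g ∈ S := by
    intro g
    obtain ⟨w, rfl⟩ := PresentedGroup.mk_surjective _ g
    induction w using FreeGroup.induction_on with
    | C1 => rw [map_one, map_one]; exact S.one_mem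
    | of i =>
      fin_cases i
      · exact hxS
      · exact hyS
    | inv_of i _ =>
      rw [map_inv]
      fin_cases i
      · change MonoidAlgebra.of F (T3m m t) (xg m t)⁻¹ ∈ S
        rw [inv_pow _ m hm (xg_pow m t), map_pow]
        exact S.pow_mem hxS _
      · change MonoidAlgebra.of F (T3m m t) (yg m t)⁻¹ ∈ S
        rw [inv_pow _ 3 (by norm_num) (yg_pow m t), map_pow]
        exact S.pow_mem hyS _
    | mul a b ha hb => rw [map_mul, map_mul]; exact S.mul_mem ha hb
  rw [eq_top_iff]
  rintro a -
  induction a using MonoidAlgebra.induction_on with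
  | of g => exact hg g
  | add a b ha hb => exact S.add_mem ha hb
  | smul r a ha => exact S.smul_mem ha r

end T3mAux

/-- For a finite field `F` of characteristic 3 and `G = T_{3m}`, the Jacobson radical
`J(FG)` equals the two-sided annihilator of `s = x̂y⁻¹ + 1 + x̂y`, the sum of all
3-elements of `G`. -/
theorem jacobson_eq_ann_s (F : Type*) [Field F] [Fintype F] [CharP F 3] (m t k : ℕ)
    (ht1 : 1 ≤ t) (hm : m = 3 * k + 1) (ht : t ^ 3 % m = 1 % m)
    (hgcd : Nat.gcd m (t - 1) = 1) :
    letI G := T3m m t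
    letI xhat : MonoidAlgebra F G := ∑ i ∈ Finset.range m, MonoidAlgebra.of F G (xg m t ^ i)
    letI s : MonoidAlgebra F G :=
      xhat * MonoidAlgebra.of F G (yg m t)⁻¹ + 1 + xhat * MonoidAlgebra.of F G (yg m t)
    ∀ α : MonoidAlgebra F G,
      α ∈ (⊥ : Ideal (MonoidAlgebra F G)).jacobson ↔ (α * s = 0 ∧ s * α = 0) := by
  intro α
  have hm0 : m ≠ 0 := by omega
  haveI : NeZero m := ⟨hm0⟩
  have h3 : (3 : F) = 0 := by exact_mod_cast CharP.cast_eq_zero F 3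
  have hm1 : (m : F) = 1 := by rw [hm]; push_cast; rw [h3]; simp
  have ht' : (t : ZMod m) ^ 3 = 1 := by
    have := (ZMod.natCast_eq_natCast_iff (t ^ 3) 1 m).2 ht
    exact_mod_cast this
  have hfix : ∀ i : ZMod m, t * i = i → i = 0 := by
    intro i hi
    have hu : IsUnit ((t - 1 : ℕ) : ZMod m) :=
      (ZMod.isUnit_iff_coprime _ _).2 (Nat.Coprime.symm hgcd)
    rw [Nat.cast_sub ht1, Nat.cast_one] at hu
    apply hu.mul_right_eq_zero.1
    rw [sub_mul, hi, one_mul, sub_self]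
  set x := MonoidAlgebra.of F (T3m m t) (xg m t) with hxd
  set y := MonoidAlgebra.of F (T3m m t) (yg m t) with hyd
  have hx : x ^ m = 1 := by rw [hxd, ← map_pow, T3mAux.xg_pow, map_one]
  have hy : y ^ 3 = 1 := by rw [hyd, ← map_pow, T3mAux.yg_pow, map_one]
  have hxy : x * y = y * x ^ t := by
    rw [hxd, hyd, ← map_pow, ← map_mul, ← map_mul, T3mAux.xg_yg]
  have hyinv : MonoidAlgebra.of F (T3m m t) (yg m t)⁻¹ = y ^ 2 := by
    rw [hyd, ← map_pow]
    congr 1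
    rw [inv_eq_iff_mul_eq_one, ← pow_succ', T3mAux.yg_pow]
  have he : ∑ i ∈ Finset.range m, MonoidAlgebra.of F (T3m m t) (xg m t ^ i) =
      ∑ i : ZMod m, T3mAux.X m x i := by
    refine (Finset.sum_bij (fun i _ => i.val) ?_ ?_ ?_ ?_).symm
    · intro i _; exact Finset.mem_range.2 (ZMod.val_lt i)
    · intro i _ j _ h; exact ZMod.val_injective m h
    · intro j hj
      exact ⟨(j : ZMod m), Finset.mem_univ _, ZMod.val_cast_of_lt (Finset.mem_range.1 hj)⟩
    · intro i _; rw [T3mAux.X, hxd, ← map_pow]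
  have hne : (∑ i ∈ Finset.range m, MonoidAlgebra.of F (T3m m t) (xg m t ^ i)) *
      (1 + y + y ^ 2) ≠ 0 := by
    intro h
    have h2 := congrArg (MonoidAlgebra.lift F (MonoidAlgebra F (Multiplicative (ZMod 3))) (T3m m t)
      ((MonoidAlgebra.of F (Multiplicative (ZMod 3))).comp (T3mAux.toC3 m t))) h
    rw [map_mul, map_sum, map_add, map_add, map_one, map_pow, map_zero, hyd] at h2
    simp only [MonoidAlgebra.lift_of, MonoidHom.comp_apply, map_pow, T3mAux.toC3_x,
      T3mAux.toC3_y, map_one, one_pow, Finset.sum_const, Finset.card_range] at h2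
    rw [← Nat.cast_smul_eq_nsmul F, hm1, one_smul, one_mul, ← map_pow,
      ← map_one (MonoidAlgebra.of F (Multiplicative (ZMod 3)))] at h2
    have h4 := congrArg (fun a : MonoidAlgebra F (Multiplicative (ZMod 3)) => a.coeff 1) h2
    have n1 : (Multiplicative.ofAdd (1 : ZMod 3)) ≠ 1 := by decide
    have n2 : (Multiplicative.ofAdd (1 : ZMod 3)) ^ 2 ≠ 1 := by decide
    simp [MonoidAlgebra.of_apply, n1, n2] at h4
  have := T3mAux.main (F := F) m t hm1 h3 ht' hfix x y hx hy hxy (T3mAux.adjoin_top F m t hm0)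
    (MonoidAlgebra.lift F F (T3m m t) 1) (by simp [hxd]) (by simp [hyd]) _ he hne α
  rw [hyinv]
  exact this
end

section
/- Let F be a finite field of characteristic 3 and G = T_{3m} with m = 3k+1. Then the Jacobson radical J(FG) is a 2-dimensional F-vector space, spanned by x̂y^{-1} − x̂ and x̂y − x̂. -/
section helpers

open MonoidAlgebra

/-- orbit-minimum selector -/
noncomputable def epsSel (F : Type*) [Field F] (m : ℕ) (τ i : ZMod m) : F :=
  if i.val < (τ * i).val ∧ i.val < (τ * (τ * i)).val then -1 else 0

lemma epsSel_sum (F : Type*) [Field F] (m : ℕ) [NeZero m] (τ : ZMod m) (h3 : τ ^ 3 = 1)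
    (hu : IsUnit (τ - 1)) (i : ZMod m) :
    epsSel F m τ i + epsSel F m τ (τ * i) + epsSel F m τ (τ * (τ * i))
      = if i = 0 then 0 else -1 := by
  by_cases hi : i = 0
  · subst hi; simp [epsSel]
  · have e3 : τ * (τ * (τ * i)) = i := by linear_combination i * h3
    have key : ∀ j : ZMod m, j ≠ 0 → j ≠ τ * j := by
      intro j hj h
      apply hj
      have : (τ - 1) * j = 0 := by linear_combination -h
      exact (hu.mul_right_eq_zero).1 this
    have h1 : i ≠ τ * i := key i hi
    have hi2 : τ * i ≠ 0 := by
      intro h; apply hi; rw [← e3, h]; simp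
    have hi3 : τ * (τ * i) ≠ 0 := by
      intro h; apply hi; rw [← e3, h]; simp
    have h2 := key _ hi2
    have h4 := key _ hi3
    rw [e3] at h4
    have v1 : i.val ≠ (τ * i).val := fun h => h1 (ZMod.val_injective m h)
    have v2 : (τ * i).val ≠ (τ * (τ * i)).val := fun h => h2 (ZMod.val_injective m h)
    have v3 : (τ * (τ * i)).val ≠ i.val := fun h => h4 (ZMod.val_injective m h)
    simp only [epsSel, e3, if_neg hi]
    generalize i.val = a at *
    generalize (τ * i).val = b at *
    generalize (τ * (τ * i)).val = c at *
    rcases lt_or_gt_of_ne v1 with p | p <;> rcases lt_or_gt_of_ne v2 with q | q <;>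
      rcases lt_or_gt_of_ne v3 with r | r <;>
      first
        | omega
        | simp [p, q, r, p.not_gt, q.not_gt, r.not_gt]

/-- If `1 - z` has `z` in the Jacobson radical and `a * z = a` then `a = 0`. -/
lemma jac_fix {A : Type*} [Ring A] {z a : A} (hz : z ∈ (⊥ : Ideal A).jacobson)
    (h : a * z = a) : a = 0 := by
  obtain ⟨w, hw⟩ := Ideal.mem_jacobson_iff.1 hz (-1)
  have hw : w * (1 - z) = 1 := by
    have := (Ideal.mem_bot).1 hw
    rw [← sub_eq_zero, ← this]; noncomm_ring
  obtain ⟨w', hw'⟩ := Ideal.mem_jacobson_iff.1 hz w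
  have hw' : w' * w = 1 := by
    have h1 := (Ideal.mem_bot).1 hw'
    have h2 : w = 1 + w * z := by rw [← hw]; noncomm_ring
    rw [h2, ← sub_eq_zero, ← h1]; noncomm_ring
  have hw2 : (1 - z) = w' := by
    calc 1 - z = (w' * w) * (1 - z) := by rw [hw', one_mul]
      _ = w' := by rw [mul_assoc, hw, mul_one]
  calc a = a * ((1 - z) * w) := by rw [hw2, hw', mul_one]
    _ = (a - a * z) * w := by noncomm_ring
    _ = 0 := by rw [h, sub_self, zero_mul]

/-- nil left ideals are in the radical -/
lemma jac_nil {A : Type*} [Ring A] {u : A} (hu : ∀ b : A, IsNilpotent (b * u)) :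
    u ∈ (⊥ : Ideal A).jacobson := by
  rw [Ideal.mem_jacobson_iff]
  intro b
  obtain ⟨w, hw⟩ := (hu b).isUnit_one_add.exists_left_inv
  refine ⟨w, ?_⟩
  rw [Ideal.mem_bot, mul_assoc, ← sub_eq_zero.2 hw]
  noncomm_ring

/-- augmentation kills the radical -/
lemma jac_aug {A F : Type*} [Ring A] [Field F] [Algebra F A] (f : A →ₐ[F] F) {a : A}
    (ha : a ∈ (⊥ : Ideal A).jacobson) : f a = 0 := by
  by_contra h
  obtain ⟨w, hw⟩ := Ideal.mem_jacobson_iff.1 ha (algebraMap F A (-(f a)⁻¹))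
  have := congrArg f ((Ideal.mem_bot).1 hw)
  simp [mul_assoc, h] at this

variable {F G : Type*} [Field F] [Group G]

/-- The hom `i ↦ x^i` from `ZMod m`. -/
def XX {m : ℕ} [NeZero m] (x : G) (i : ZMod m) : G := x ^ i.val

lemma pow_congr {m : ℕ} {x : G} (hx : x ^ m = 1) {a b : ℕ} (h : (a : ZMod m) = b) :
    x ^ a = x ^ b := by
  rw [ZMod.natCast_eq_natCast_iff] at h
  rw [pow_eq_pow_iff_modEq]
  exact h.of_dvd (orderOf_dvd_of_pow_eq_one hx)

lemma XX_add {m : ℕ} [NeZero m] {x : G} (hx : x ^ m = 1) (i j : ZMod m) :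
    XX x (i + j) = XX x i * XX x j := by
  unfold XX
  rw [← pow_add]
  exact pow_congr hx (by simp)

lemma XX_conj {m : ℕ} [NeZero m] {x y : G} {t : ℕ} (hx : x ^ m = 1)
    (hxy : y⁻¹ * x * y = x ^ t) (i : ZMod m) :
    y⁻¹ * XX x i * y = XX x ((t : ZMod m) * i) := by
  unfold XX
  have := conj_pow (a := y⁻¹) (b := x) (i := i.val)
  rw [inv_inv] at this
  rw [← this, hxy, ← pow_mul]
  exact pow_congr hx (by simp)

/-- The element `x̂`. -/
noncomputable def xh (F : Type*) [Field F] {m : ℕ} [NeZero m] (x : G) : MonoidAlgebra F G :=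
  ∑ i : ZMod m, of F G (XX x i)

lemma xh_eq {m : ℕ} [NeZero m] (x : G) :
    xh F (m := m) x = ∑ i ∈ Finset.range m, of F G (x ^ i) := by
  unfold xh XX
  refine Finset.sum_bij (fun i _ => i.val) ?_ ?_ ?_ ?_
  · intro i _; simpa using ZMod.val_lt i
  · intro i _ j _ h; exact ZMod.val_injective m h
  · intro b hb; exact ⟨b, Finset.mem_univ _, ZMod.val_cast_of_lt (by simpa using hb)⟩
  · intros; rfl

lemma xh_mul_XX {m : ℕ} [NeZero m] {x : G} (hx : x ^ m = 1) (a : ZMod m) :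
    xh F (m := m) x * of F G (XX x a) = xh F (m := m) x := by
  unfold xh
  rw [Finset.sum_mul]
  refine Fintype.sum_equiv (Equiv.addRight a) _ _ fun i => ?_
  simp only [← map_mul, ← XX_add hx]; rfl

lemma XX_mul_xh {m : ℕ} [NeZero m] {x : G} (hx : x ^ m = 1) (a : ZMod m) :
    of F G (XX x a) * xh F (m := m) x = xh F (m := m) x := by
  unfold xh
  rw [Finset.mul_sum]
  refine Fintype.sum_equiv (Equiv.addLeft a) _ _ fun i => ?_
  simp only [← map_mul, ← XX_add hx]; rfl

lemma x_eq {m : ℕ} [NeZero m] {x : G} (hx : x ^ m = 1) : XX x (1 : ZMod m) = x := by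
  unfold XX
  conv_rhs => rw [← pow_one x]
  exact pow_congr hx (by simp)

/-- multiplication by a unit, as a permutation -/
def mulPerm {m : ℕ} {τ : ZMod m} (h3 : τ ^ 3 = 1) : ZMod m ≃ ZMod m where
  toFun i := τ * i
  invFun i := τ * (τ * i)
  left_inv i := by show τ * (τ * (τ * i)) = i; linear_combination i * h3
  right_inv i := by show τ * (τ * (τ * i)) = i; linear_combination i * h3

lemma y_mul_xh {m : ℕ} [NeZero m] {x y : G} {t : ℕ} (hx : x ^ m = 1)
    (hxy : y⁻¹ * x * y = x ^ t) (h3 : (t : ZMod m) ^ 3 = 1) :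
    of F G y * xh F (m := m) x = xh F (m := m) x * of F G y := by
  unfold xh
  rw [Finset.mul_sum, Finset.sum_mul]
  refine (Fintype.sum_equiv (mulPerm h3) _ _ fun i => ?_).symm
  simp only [← map_mul]
  congr 1
  show XX x i * y = y * XX x ((t : ZMod m) * i)
  rw [← XX_conj hx hxy]; group

/-- `x̂` is central. -/
lemma xh_central {m : ℕ} [NeZero m] {x y : G} {t : ℕ} (hx : x ^ m = 1)
    (hxy : y⁻¹ * x * y = x ^ t) (h3 : (t : ZMod m) ^ 3 = 1)
    (hgen : Subgroup.closure {x, y} = ⊤) (a : MonoidAlgebra F G) :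
    Commute a (xh F (m := m) x) := by
  have hg : ∀ g : G, Commute (of F G g) (xh F (m := m) x) := by
    intro g
    have : g ∈ Subgroup.closure {x, y} := hgen ▸ Subgroup.mem_top g
    induction this using Subgroup.closure_induction with
    | mem g hg =>
      rcases hg with rfl | rfl
      · have h1 := XX_mul_xh (F := F) hx 1
        have h2 := xh_mul_XX (F := F) hx 1
        rw [x_eq hx] at h1 h2
        exact h1.trans h2.symm
      · exact y_mul_xh hx hxy h3
    | one => rw [map_one]; exact Commute.one_left _
    | mul a b _ _ h1 h2 => rw [map_mul]; exact h1.mul_left h2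
    | inv a _ h =>
      have e1 : of F G a⁻¹ * of F G a = 1 := by rw [← map_mul]; simp [MonoidAlgebra.one_def]
      have e2 : of F G a * of F G a⁻¹ = 1 := by rw [← map_mul]; simp [MonoidAlgebra.one_def]
      show of F G a⁻¹ * _ = _ * of F G a⁻¹
      calc of F G a⁻¹ * xh F (m := m) x
          = of F G a⁻¹ * (xh F (m := m) x * of F G a) * of F G a⁻¹ := by
            rw [mul_assoc, mul_assoc, e2, mul_one]
        _ = of F G a⁻¹ * (of F G a * xh F (m := m) x) * of F G a⁻¹ := by rw [h.eq]
        _ = xh F (m := m) x * of F G a⁻¹ := by rw [← mul_assoc (of F G a⁻¹), e1, one_mul]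
  induction a using MonoidAlgebra.induction_on with
  | of g => exact hg g
  | add a b h1 h2 => exact h1.add_left h2
  | smul r a h => exact h.smul_left r

lemma xh_sq {m : ℕ} [NeZero m] {x : G} (hx : x ^ m = 1) (hm : (m : F) = 1) :
    xh F (m := m) x * xh F (m := m) x = xh F (m := m) x := by
  conv_lhs => enter [2]; unfold xh
  rw [Finset.mul_sum, Finset.sum_congr rfl fun i _ => xh_mul_XX hx i]
  simp only [Finset.sum_const, Finset.card_univ, ZMod.card]
  rw [← Nat.cast_smul_eq_nsmul F, hm, one_smul]

/-- normal form -/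
lemma normal_form {m : ℕ} [NeZero m] {x y : G} {t : ℕ} (hx : x ^ m = 1) (hy : y ^ 3 = 1)
    (hxy : y⁻¹ * x * y = x ^ t)
    (hgen : Subgroup.closure {x, y} = ⊤) (g : G) :
    ∃ (n : ℕ) (i : ZMod m), g = y ^ n * XX x i := by
  have hX0 : XX x (0 : ZMod m) = 1 := by simp [XX]
  have hc : ∀ (n : ℕ) (i : ZMod m), ∃ j : ZMod m, XX x i * y ^ n = y ^ n * XX x j := by
    intro n
    induction n with
    | zero => intro i; exact ⟨i, by simp⟩
    | succ n ih =>
      intro i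
      obtain ⟨j, hj⟩ := ih i
      refine ⟨t * j, ?_⟩
      rw [pow_succ, ← mul_assoc, hj, ← XX_conj hx hxy]; group
  have : g ∈ Subgroup.closure {x, y} := hgen ▸ Subgroup.mem_top g
  induction this using Subgroup.closure_induction with
  | mem g hg =>
    rcases hg with rfl | rfl
    · exact ⟨0, 1, by rw [x_eq hx]; simp⟩
    · exact ⟨1, 0, by rw [hX0]; simp⟩
  | one => exact ⟨0, 0, by rw [hX0]; simp⟩
  | mul a b _ _ h1 h2 =>
    obtain ⟨n, i, rfl⟩ := h1
    obtain ⟨k, j, rfl⟩ := h2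
    obtain ⟨l, hl⟩ := hc k i
    refine ⟨n + k, l + j, ?_⟩
    rw [XX_add hx, pow_add]
    calc y ^ n * XX x i * (y ^ k * XX x j) = y ^ n * (XX x i * y ^ k) * XX x j := by group
      _ = _ := by rw [hl]; group
  | inv a _ h =>
    obtain ⟨n, i, rfl⟩ := h
    obtain ⟨l, hl⟩ := hc (2 * n) (-i)
    refine ⟨2 * n, l, ?_⟩
    rw [← hl, inv_eq_iff_mul_eq_one]
    have h1 : XX x i * XX x (-i) = 1 := by rw [← XX_add hx]; simp [hX0]
    calc y ^ n * XX x i * (XX x (-i) * y ^ (2 * n))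
        = y ^ n * (XX x i * XX x (-i)) * y ^ (2 * n) := by group
      _ = (y ^ 3) ^ n := by rw [h1, mul_one, ← pow_add, ← pow_mul]; congr 1; ring
      _ = 1 := by rw [hy, one_pow]

/-- `b x̂ = x̂ (α + β y + γ y⁻¹)`. -/
lemma xh_mul_form {m : ℕ} [NeZero m] {x y : G} {t : ℕ} (hx : x ^ m = 1) (hy : y ^ 3 = 1)
    (hxy : y⁻¹ * x * y = x ^ t) (h3 : (t : ZMod m) ^ 3 = 1)
    (hgen : Subgroup.closure {x, y} = ⊤) (b : MonoidAlgebra F G) :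
    ∃ α β γ : F, b * xh F (m := m) x =
      xh F (m := m) x * (α • 1 + β • of F G y + γ • of F G y⁻¹) := by
  induction b using MonoidAlgebra.induction_on with
  | of g =>
    obtain ⟨n, i, rfl⟩ := normal_form (m := m) hx hy hxy hgen g
    rw [map_mul, mul_assoc, XX_mul_xh hx, (xh_central hx hxy h3 hgen _).eq]
    have h : y ^ n = y ^ (n % 3) := by
      conv_lhs => rw [← Nat.div_add_mod n 3, pow_add, pow_mul, hy, one_pow, one_mul]
    have h' : y ^ 2 = y⁻¹ := by
      rw [eq_inv_iff_mul_eq_one, ← pow_succ, hy]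
    have : n % 3 < 3 := Nat.mod_lt _ (by norm_num)
    rw [h]
    interval_cases n % 3
    · exact ⟨1, 0, 0, by rw [pow_zero, map_one]; simp⟩
    · exact ⟨0, 1, 0, by simp⟩
    · exact ⟨0, 0, 1, by rw [h']; simp⟩
  | add a b h1 h2 =>
    obtain ⟨α, β, γ, h⟩ := h1
    obtain ⟨α', β', γ', h'⟩ := h2
    refine ⟨α + α', β + β', γ + γ', ?_⟩
    rw [add_mul, h, h', ← mul_add]
    congr 1
    module
  | smul r a h =>
    obtain ⟨α, β, γ, h⟩ := h
    refine ⟨r * α, r * β, r * γ, ?_⟩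
    rw [smul_mul_assoc, h, ← mul_smul_comm]
    congr 1
    module

/-- The spanning vectors lie in the radical. -/
lemma gen_mem_jac [CharP F 3] {m : ℕ} [NeZero m] {x y : G} {t : ℕ} (hx : x ^ m = 1)
    (hy : y ^ 3 = 1)
    (hxy : y⁻¹ * x * y = x ^ t) (h3 : (t : ZMod m) ^ 3 = 1)
    (hgen : Subgroup.closure {x, y} = ⊤) (g : G) (hg : g = y ∨ g = y⁻¹) :
    xh F (m := m) x * of F G g - xh F (m := m) x ∈
      (⊥ : Ideal (MonoidAlgebra F G)).jacobson := by
  have : CharP (MonoidAlgebra F G) 3 := charP_of_injective_algebraMap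
    (algebraMap F (MonoidAlgebra F G)).injective 3
  have : Fact (Nat.Prime 3) := ⟨by norm_num⟩
  apply jac_nil
  intro b
  obtain ⟨α, β, γ, h⟩ := xh_mul_form (F := F) hx hy hxy h3 hgen b
  have e : b * (xh F (m := m) x * of F G g - xh F (m := m) x) =
    xh F (m := m) x * ((α • 1 + β • of F G y + γ • of F G y⁻¹) * (of F G g - 1)) := by
    rw [← mul_assoc, ← h]; noncomm_ring
  rw [e]
  refine ⟨3, ?_⟩
  have hcg1 : Commute y g := by rcases hg with rfl | rfl <;> simp
  have hcg2 : Commute y⁻¹ g := by rcases hg with rfl | rfl <;> simp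
  have hc1 : Commute (of F G y) (of F G g) := hcg1.map _
  have hc2 : Commute (of F G y⁻¹) (of F G g) := hcg2.map _
  have hc : Commute (α • 1 + β • of F G y + γ • of F G y⁻¹) (of F G g - 1) := by
    refine Commute.sub_right ?_ (Commute.one_right _)
    exact (((Commute.one_left _).smul_left _).add_left (hc1.smul_left _)).add_left
      (hc2.smul_left _)
  have hg3 : g ^ 3 = 1 := by rcases hg with rfl | rfl <;> simp [hy]
  rw [((xh_central hx hxy h3 hgen _).symm).mul_pow, hc.mul_pow,
    sub_pow_char_of_commute 3 (Commute.one_right _), ← map_pow, hg3, map_one,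
    one_pow, sub_self, mul_zero, mul_zero]

/-- conjugation-averaging element -/
noncomputable def cc (F : Type*) [Field F] {m : ℕ} [NeZero m] (x : G) (τ : ZMod m) :
    MonoidAlgebra F G := ∑ i : ZMod m, epsSel F m τ i • of F G (XX x i)

/-- inner sum over conjugates -/
lemma cc_conj {m : ℕ} [NeZero m] {x y : G} {t : ℕ} (hx : x ^ m = 1) (hy : y ^ 3 = 1)
    (hxy : y⁻¹ * x * y = x ^ t) (h3 : (t : ZMod m) ^ 3 = 1)
    (hu : IsUnit ((t : ZMod m) - 1)) :
    cc F x (t : ZMod m) + of F G y⁻¹ * cc F x (t : ZMod m) * of F G y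
      + of F G y * cc F x (t : ZMod m) * of F G y⁻¹ = 1 - xh F (m := m) x := by
  have hy' : y⁻¹ * y⁻¹ = y := by
    rw [← mul_inv_rev, inv_eq_iff_mul_eq_one, ← hy, pow_succ, pow_two]
  have hyy : y * y = y⁻¹ := by rw [← inv_inj, mul_inv_rev, hy', inv_inv]
  have e3 : ∀ i : ZMod m, (t : ZMod m) * (t * (t * i)) = i := fun i => by
    linear_combination i * h3
  have c1 : of F G y⁻¹ * cc F x (t : ZMod m) * of F G y =
      ∑ i : ZMod m, epsSel F m t (t * (t * i)) • of F G (XX x i) := by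
    unfold cc
    rw [Finset.mul_sum, Finset.sum_mul]
    refine Fintype.sum_equiv (mulPerm h3) _ _ fun i => ?_
    show _ = epsSel F m t ((t : ZMod m) * ((t : ZMod m) * ((t : ZMod m) * i))) • of F G (XX x ((t : ZMod m) * i))
    rw [e3, mul_smul_comm, smul_mul_assoc, ← map_mul, ← map_mul, XX_conj hx hxy]
  have c2 : of F G y * cc F x (t : ZMod m) * of F G y⁻¹ =
      ∑ i : ZMod m, epsSel F m t (t * i) • of F G (XX x i) := by
    unfold cc
    rw [Finset.mul_sum, Finset.sum_mul]
    refine Fintype.sum_equiv (mulPerm h3).symm _ _ fun i => ?_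
    show _ = epsSel F m t ((t : ZMod m) * ((t : ZMod m) * ((t : ZMod m) * i))) • of F G (XX (m := m) x ((t : ZMod m) * ((t : ZMod m) * i)))
    rw [e3, mul_smul_comm, smul_mul_assoc, ← map_mul, ← map_mul, ← XX_conj hx hxy,
      ← XX_conj hx hxy]
    congr 2
    calc y * XX x i * y⁻¹ = (y⁻¹ * y⁻¹) * XX x i * (y * y) := by rw [hy', hyy]
      _ = _ := by group
  have h_one : (1 : MonoidAlgebra F G) =
      ∑ i : ZMod m, (if i = 0 then (1 : F) else 0) • of F G (XX x i) := by
    simp [XX, MonoidAlgebra.one_def]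
  rw [c1, c2, h_one]
  unfold cc xh
  rw [← Finset.sum_add_distrib, ← Finset.sum_add_distrib, ← Finset.sum_sub_distrib]
  refine Finset.sum_congr rfl fun i _ => ?_
  have := epsSel_sum F m (t : ZMod m) h3 hu i
  rw [← add_smul, ← add_smul]
  have e : epsSel F m t i + epsSel F m t (t * (t * i)) + epsSel F m t (t * i)
      = (if i = 0 then (1 : F) else 0) - 1 := by
    rw [add_right_comm, this]; split_ifs <;> simp
  rw [e, sub_smul, one_smul]

/-- `(1 - x̂) J = 0`. -/
lemma jac_eq {m : ℕ} [NeZero m] {x y : G} {t : ℕ} (hx : x ^ m = 1) (hy : y ^ 3 = 1)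
    (hxy : y⁻¹ * x * y = x ^ t) (h3 : (t : ZMod m) ^ 3 = 1)
    (hu : IsUnit ((t : ZMod m) - 1)) (hm : (m : F) = 1)
    (hgen : Subgroup.closure {x, y} = ⊤) {a : MonoidAlgebra F G}
    (ha : a ∈ (⊥ : Ideal (MonoidAlgebra F G)).jacobson) :
    (1 - xh F (m := m) x) * a = 0 := by
  set J := (⊥ : Ideal (MonoidAlgebra F G)).jacobson with hJ
  obtain ⟨p, hp⟩ := (J.restrictScalars F).subtype.exists_leftInverse_of_injective
    (Submodule.ker_subtype _)
  let q : MonoidAlgebra F G → MonoidAlgebra F G := fun v => (p v : MonoidAlgebra F G)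
  have hqJ : ∀ v, q v ∈ J := fun v => (p v).2
  have hqadd : ∀ v w, q (v + w) = q v + q w := fun v w => by simp [q]
  have hqsmul : ∀ (r : F) v, q (r • v) = r • q v := fun r v => by simp [q]
  have hqid : ∀ v ∈ J, q v = v := fun v hv => by
    have := LinearMap.congr_fun hp ⟨v, hv⟩
    exact congrArg Subtype.val this
  let c := cc F x (t : ZMod m)
  -- term for the group element `g`
  let T : G → MonoidAlgebra F G → MonoidAlgebra F G :=
    fun g v => of F G g⁻¹ * c * q (of F G g * v)
  have hT : ∀ g h v, T g (of F G h * v) = of F G h * T (g * h) v := by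
    intro g h v
    simp only [T]
    rw [← mul_assoc (of F G g), ← map_mul, ← mul_assoc, ← mul_assoc, ← map_mul]
    congr 3
    group
  let P : MonoidAlgebra F G → MonoidAlgebra F G := fun v =>
    ∑ i : ZMod m, (T (XX x i) v + T (y * XX x i) v + T (y⁻¹ * XX x i) v)
  have hPadd : ∀ v w, P (v + w) = P v + P w := by
    intro v w
    simp only [P, T, mul_add, hqadd, ← Finset.sum_add_distrib]
    refine Finset.sum_congr rfl fun i _ => ?_
    abel
  have hPsmul : ∀ (r : F) v, P (r • v) = r • P v := by
    intro r v
    simp only [P, T, mul_smul_comm, hqsmul, Finset.smul_sum, smul_add]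
  have hPJ : ∀ v, P v ∈ J := by
    intro v
    refine Submodule.sum_mem _ fun i _ => ?_
    exact J.add_mem (J.add_mem (J.mul_mem_left _ (hqJ _)) (J.mul_mem_left _ (hqJ _)))
      (J.mul_mem_left _ (hqJ _))
  have hPX : ∀ a v, P (of F G (XX x (a : ZMod m)) * v) = of F G (XX x a) * P v := by
    intro a v
    simp only [P]
    rw [Finset.mul_sum]
    refine Fintype.sum_equiv (Equiv.addRight a) _ _ fun i => ?_
    simp only [hT, Equiv.coe_addRight, XX_add hx, mul_add, mul_assoc]
  have hyy : y * y = y⁻¹ := by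
    rw [eq_inv_iff_mul_eq_one, ← hy, pow_succ, pow_two]
  have hPy : ∀ v, P (of F G y * v) = of F G y * P v := by
    intro v
    simp only [P]
    rw [Finset.mul_sum]
    refine Fintype.sum_equiv (mulPerm h3) _ _ fun i => ?_
    show _ = of F G y * (T (XX x ((t : ZMod m) * i)) v + T (y * XX x ((t : ZMod m) * i)) v
      + T (y⁻¹ * XX x ((t : ZMod m) * i)) v)
    simp only [hT, mul_add]
    have g0 : XX x i * y = y * XX x ((t : ZMod m) * i) := by rw [← XX_conj hx hxy]; group
    have g1 : y * XX x i * y = y⁻¹ * XX x ((t : ZMod m) * i) := by rw [mul_assoc, g0, ← mul_assoc, hyy]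
    have g2 : y⁻¹ * XX x i * y = XX x ((t : ZMod m) * i) := XX_conj hx hxy i
    rw [g0, g1, g2]
    abel
  have hPpow : ∀ (n : ℕ) v, P (of F G (y ^ n) * v) = of F G (y ^ n) * P v := by
    intro n
    induction n with
    | zero => intro v; rw [pow_zero, map_one, one_mul, one_mul]
    | succ n ih => intro v; rw [pow_succ, map_mul, mul_assoc, ih, hPy, mul_assoc]
  have hPlin : ∀ v, P v = v * P 1 := by
    intro v
    induction v using MonoidAlgebra.induction_on with
    | of g =>
      obtain ⟨n, i, rfl⟩ := normal_form (m := m) hx hy hxy hgen g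
      rw [map_mul, mul_assoc, ← hPX, ← hPpow, mul_one]
    | add a b h1 h2 => rw [hPadd, h1, h2, add_mul]
    | smul r a h => rw [hPsmul, h, smul_mul_assoc]
  have hcent := xh_central (F := F) hx hxy h3 hgen
  have hPid : ∀ v ∈ J, P v = (1 - xh F (m := m) x) * v := by
    intro v hv
    have hTv : ∀ g, T g v = of F G g⁻¹ * c * of F G g * v := by
      intro g
      simp only [T]
      rw [hqid _ (J.mul_mem_left _ hv), mul_assoc]
      simp only [mul_assoc]
    have hi : ∀ i : ZMod m, T (XX x i) v + T (y * XX x i) v + T (y⁻¹ * XX x i) v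
        = (1 - xh F (m := m) x) * v := by
      intro i
      have e1 : of F G (XX x i)⁻¹ * of F G (XX x i) = 1 := by rw [← map_mul]; simp [MonoidAlgebra.one_def]
      calc _ = of F G (XX x i)⁻¹ * (c + of F G y⁻¹ * c * of F G y + of F G y * c * of F G y⁻¹)
              * of F G (XX x i) * v := by
            simp only [hTv, mul_inv_rev, inv_inv, map_mul, mul_add, add_mul, mul_assoc]
        _ = _ := by
            rw [cc_conj hx hy hxy h3 hu, mul_assoc (of F G (XX x i)⁻¹),
              ((Commute.one_right (of F G (XX x i))).sub_right (hcent _)).symm.eq,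
              ← mul_assoc, e1, one_mul]
    simp only [P, hi, Finset.sum_const, Finset.card_univ, ZMod.card]
    rw [← Nat.cast_smul_eq_nsmul F, hm, one_smul]
  have hz := hPJ 1
  have k1 : ∀ v ∈ J, v * P 1 = (1 - xh F (m := m) x) * v := fun v hv => by
    rw [← hPlin, hPid v hv]
  have hidem : (1 - xh F (m := m) x) * (1 - xh F (m := m) x) = 1 - xh F (m := m) x := by
    rw [mul_sub, sub_mul, sub_mul, xh_sq hx hm]; simp
  apply jac_fix hz
  rw [k1 _ (J.mul_mem_left _ ha), ← mul_assoc, hidem]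

lemma main_eq [CharP F 3] {m : ℕ} [NeZero m] {x y : G} {t : ℕ} (hx : x ^ m = 1) (hy : y ^ 3 = 1)
    (hxy : y⁻¹ * x * y = x ^ t) (h3 : (t : ZMod m) ^ 3 = 1)
    (hu : IsUnit ((t : ZMod m) - 1)) (hm : (m : F) = 1)
    (hgen : Subgroup.closure {x, y} = ⊤) :
    ((⊥ : Ideal (MonoidAlgebra F G)).jacobson : Set (MonoidAlgebra F G))
      = (Submodule.span F {xh F (m := m) x * of F G y⁻¹ - xh F (m := m) x,
          xh F (m := m) x * of F G y - xh F (m := m) x} : Submodule F (MonoidAlgebra F G)) := by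
  apply Set.Subset.antisymm
  · intro a ha
    have ha : a ∈ (⊥ : Ideal (MonoidAlgebra F G)).jacobson := ha
    have h0 := jac_eq hx hy hxy h3 hu hm hgen ha
    obtain ⟨α, β, γ, h⟩ := xh_mul_form (F := F) hx hy hxy h3 hgen a
    rw [(xh_central hx hxy h3 hgen a).eq] at h
    rw [sub_mul, one_mul, sub_eq_zero] at h0
    have ea : a = xh F (m := m) x * (α • 1 + β • of F G y + γ • of F G y⁻¹) := h0.trans h
    let f : MonoidAlgebra F G →ₐ[F] F := MonoidAlgebra.lift F F G 1
    have hf : ∀ g : G, f (of F G g) = 1 := fun g => by simp [f]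
    have hxf : f (xh F (m := m) x) = 1 := by
      unfold xh
      rw [map_sum]
      simp only [hf, Finset.sum_const, Finset.card_univ, ZMod.card, nsmul_eq_mul, mul_one, hm]
    have haug : α + β + γ = 0 := by
      have := jac_aug f ha
      rw [ea] at this
      simpa only [map_mul, map_add, map_smul, hxf, hf, map_one, smul_eq_mul, mul_one, one_mul]
        using this
    show a ∈ Submodule.span F _
    rw [Submodule.mem_span_pair]
    refine ⟨γ, β, ?_⟩
    have : α = -β - γ := by linear_combination haug
    rw [ea, this]
    simp only [mul_add, mul_smul_comm, mul_one]
    module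
  · let J' := ((⊥ : Ideal (MonoidAlgebra F G)).jacobson).restrictScalars F
    show (Submodule.span F _ : Submodule F (MonoidAlgebra F G)) ≤ J'
    rw [Submodule.span_le]
    rintro _ (rfl | rfl)
    · exact gen_mem_jac hx hy hxy h3 hgen _ (Or.inr rfl)
    · exact gen_mem_jac hx hy hxy h3 hgen _ (Or.inl rfl)

lemma main_rank {m : ℕ} [NeZero m] {x y : G} (hm : (m : F) = 1)
    (φ : G →* Multiplicative (ZMod 3)) (hφx : φ x = 1) (hφy : φ y = Multiplicative.ofAdd 1) :
    Module.finrank F (Submodule.span F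
      ({xh F (m := m) x * of F G y⁻¹ - xh F (m := m) x,
          xh F (m := m) x * of F G y - xh F (m := m) x} : Set (MonoidAlgebra F G))) = 2 := by
  let f : MonoidAlgebra F G →ₐ[F] MonoidAlgebra F (Multiplicative (ZMod 3)) :=
    MonoidAlgebra.lift F _ G ((of F _).comp φ)
  have hf : ∀ g, f (of F G g) = of F _ (φ g) := fun g => by simp [f]
  have hxf : f (xh F (m := m) x) = 1 := by
    unfold xh XX
    rw [map_sum]
    simp only [hf, map_pow, hφx, one_pow, Finset.sum_const, Finset.card_univ, ZMod.card, map_one]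
    rw [← Nat.cast_smul_eq_nsmul F, hm, one_smul]
  have hli : LinearIndependent F ![xh F (m := m) x * of F G y⁻¹ - xh F (m := m) x,
          xh F (m := m) x * of F G y - xh F (m := m) x] := by
    rw [LinearIndependent.pair_iff]
    intro s r h
    have h := congrArg f h
    simp only [map_add, map_smul, map_sub, map_mul, hxf, one_mul, hf, hφy, map_inv, map_zero] at h
    have n1 : (Multiplicative.ofAdd (1 : ZMod 3))⁻¹ ≠ Multiplicative.ofAdd 1 := by decide
    have n2 : (Multiplicative.ofAdd (1 : ZMod 3)) ≠ 1 := by decide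
    have n3 : (Multiplicative.ofAdd (1 : ZMod 3))⁻¹ ≠ 1 := by decide
    have a1 := congrArg (fun z => z.coeff (Multiplicative.ofAdd (1 : ZMod 3))) h
    have a2 := congrArg (fun z => z.coeff (Multiplicative.ofAdd (1 : ZMod 3))⁻¹) h
    simp [MonoidAlgebra.one_def, Finsupp.single_apply, n1, n1.symm, n2, n2.symm, n3, n3.symm] at a1 a2
    exact ⟨a2, a1⟩
  have := finrank_span_eq_card hli
  rw [Matrix.range_cons, Matrix.range_cons, Matrix.range_empty, Set.union_empty,
    Set.singleton_union] at this
  simpa using this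

end helpers

/-- For a finite field `F` of characteristic 3 and `G = T_{3m}`, `J(FG)` is the 2-dimensional
`F`-vector space spanned by `x̂y⁻¹ − x̂` and `x̂y − x̂`. -/
theorem jacobson_dim_two (F : Type*) [Field F] [Fintype F] [CharP F 3] (m t k : ℕ)
    (ht1 : 1 ≤ t) (hm : m = 3 * k + 1) (ht : t ^ 3 % m = 1 % m)
    (hgcd : Nat.gcd m (t - 1) = 1) :
    letI G := T3m m t
    letI xhat : MonoidAlgebra F G := ∑ i ∈ Finset.range m, MonoidAlgebra.of F G (xg m t ^ i)
    (((⊥ : Ideal (MonoidAlgebra F G)).jacobson : Set (MonoidAlgebra F G))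
        = (Submodule.span F {xhat * MonoidAlgebra.of F G (yg m t)⁻¹ - xhat,
            xhat * MonoidAlgebra.of F G (yg m t) - xhat} : Submodule F (MonoidAlgebra F G))) ∧
    Module.finrank F (Submodule.span F ({xhat * MonoidAlgebra.of F G (yg m t)⁻¹ - xhat,
        xhat * MonoidAlgebra.of F G (yg m t) - xhat} : Set (MonoidAlgebra F G))) = 2 := by
  have hm0 : NeZero m := ⟨by omega⟩
  have hmF : (m : F) = 1 := by
    have h3 : (3 : F) = 0 := by exact_mod_cast CharP.cast_eq_zero F 3
    rw [hm]; push_cast; rw [h3]; simp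
  have h3 : (t : ZMod m) ^ 3 = 1 := by
    have : ((t ^ 3 : ℕ) : ZMod m) = ((1 : ℕ) : ZMod m) :=
      (ZMod.natCast_eq_natCast_iff _ _ _).2 ht
    simpa using this
  have hu : IsUnit ((t : ZMod m) - 1) := by
    have : ((t : ZMod m) - 1) = ((t - 1 : ℕ) : ZMod m) := by
      rw [Nat.cast_sub ht1]; simp
    rw [this, ZMod.isUnit_iff_coprime]
    exact (Nat.Coprime.symm hgcd)
  have hx : xg m t ^ m = 1 := by
    have : PresentedGroup.mk (T3mRels m t) (FreeGroup.of 0 ^ m) = 1 :=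
      PresentedGroup.one_of_mem (by simp [T3mRels])
    rwa [map_pow] at this
  have hy : yg m t ^ 3 = 1 := by
    have : PresentedGroup.mk (T3mRels m t) (FreeGroup.of 1 ^ 3) = 1 :=
      PresentedGroup.one_of_mem (by simp [T3mRels])
    rwa [map_pow] at this
  have hxy : (yg m t)⁻¹ * xg m t * yg m t = xg m t ^ t := by
    have : PresentedGroup.mk (T3mRels m t)
        ((FreeGroup.of 1)⁻¹ * FreeGroup.of 0 * FreeGroup.of 1 * (FreeGroup.of 0 ^ t)⁻¹) = 1 :=
      PresentedGroup.one_of_mem (by simp [T3mRels])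
    rwa [map_mul, map_inv, mul_inv_eq_one, map_mul, map_mul, map_inv, map_pow] at this
  have hgen : Subgroup.closure {xg m t, yg m t} = ⊤ := by
    rw [← PresentedGroup.closure_range_of (T3mRels m t)]
    congr 1
    ext g
    simp [Fin.exists_fin_two, xg, yg, eq_comm]
  have hrel : ∀ r ∈ T3mRels m t,
      FreeGroup.lift ![1, Multiplicative.ofAdd (1 : ZMod 3)] r = 1 := by
    rintro r (rfl | rfl | rfl)
    · simp
    · simp; decide
    · simp
  have h1 := main_eq (F := F) hx hy hxy h3 hu hmF hgen
  have h2 := main_rank (F := F) (m := m) (x := xg m t) (y := yg m t) hmF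
    (PresentedGroup.toGroup hrel) (by simp [xg]) (by simp [yg])
  rw [xh_eq] at h1 h2
  exact ⟨h1, h2⟩
end

section
/- Let F be a finite field of characteristic 3, G = T_{3m} with m = 3k+1, and H = ⟨x⟩. Then J(FG) ∩ Δ(G,H) = 0, where Δ(G,H) is the relative augmentation ideal. -/
open MonoidAlgebra in
theorem aux_cyclic {F : Type*} [Field F] [CharP F 3] {H : Type*} [Group H] [Finite H]
    (xi : H) (hgen : ∀ h, h ∈ Subgroup.zpowers xi) (m t k : ℕ) (ht1 : 1 ≤ t)
    (hm : m = 3 * k + 1) (hx : xi ^ m = 1)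
    (ht : xi ^ (t ^ 3) = xi) (hgcd : Nat.gcd m (t - 1) = 1) (a : MonoidAlgebra F H)
    (hnil : IsNilpotent ((single xi 1 ^ (t ^ 2) - single xi 1) *
      ((single xi 1 ^ t - single xi 1) * a))) (g : H) : a.coeff g = a.coeff 1 := by
  have hmF : (m : F) = 1 := by
    have h3 : (3 : F) = 0 := by exact_mod_cast CharP.cast_eq_zero F 3
    rw [hm]; push_cast; rw [h3]; ring
  have : IsCyclic H := ⟨xi, hgen⟩
  let : CommGroup H := IsCyclic.commGroup
  have hcard : Nat.card H = orderOf xi := (orderOf_eq_card_of_forall_mem_zpowers hgen).symm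
  have hdvd : Nat.card H ∣ m := hcard ▸ orderOf_dvd_of_pow_eq_one hx
  have : NeZero (Nat.card H : F) := ⟨fun h0 => by
    obtain ⟨c, hc⟩ := hdvd
    rw [hc] at hmF; push_cast at hmF; rw [h0] at hmF; simp at hmF⟩
  have hred : IsReduced (MonoidAlgebra F H) := inferInstance
  have h0 := hnil.eq_zero
  set X : MonoidAlgebra F H := single xi 1 with hX
  have hXpow : ∀ n, X ^ n = single (xi ^ n) 1 := fun n => by simp [hX, single_pow]
  have hXm : X ^ m = 1 := by rw [hXpow, hx]; rfl
  have hX3 : X ^ (t ^ 3) = X := by rw [hXpow, ht]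
  have hcop : (t - 1).Coprime (orderOf xi) := by
    have : (t - 1).Coprime m := by rw [Nat.coprime_comm]; exact hgcd
    exact this.coprime_dvd_right (orderOf_dvd_of_pow_eq_one hx)
  obtain ⟨j, hj⟩ := exists_pow_eq_self_of_coprime hcop
  have hXj : (X ^ (t - 1)) ^ j = X := by
    rw [← pow_mul, hXpow, pow_mul, hj]
  have hiter : ∀ (p q b : MonoidAlgebra F H), p * b = q * b → ∀ n : ℕ, p ^ n * b = q ^ n * b := by
    intro p q b h n
    induction n with
    | zero => simp
    | succ n ih =>
      calc p ^ (n + 1) * b = p * (p ^ n * b) := by ring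
        _ = q ^ n * (p * b) := by rw [ih]; ring
        _ = q ^ (n + 1) * b := by rw [h]; ring
  have hinv : ∀ b, X ^ t * b = X * b → X * b = b := by
    intro b hb
    have hu : IsUnit X := IsUnit.of_pow_eq_one hXm (by omega)
    have h1 : X ^ (t - 1) * b = 1 * b := by
      apply hu.mul_left_cancel
      rw [one_mul, ← hb, ← mul_assoc, ← pow_succ', Nat.sub_add_cancel ht1]
    have := hiter _ _ _ h1 j
    rwa [hXj, one_pow, one_mul] at this
  set b := (X ^ t - X) * a with hb
  have hb1 : X ^ (t ^ 2) * b = X * b := by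
    rw [sub_mul] at h0; exact sub_eq_zero.mp h0
  have hb2 : X * b = b := by
    apply hinv
    have := hiter _ _ _ hb1 t
    rw [← pow_mul, ← pow_succ, hX3] at this
    exact this.symm
  have hu : IsUnit X := IsUnit.of_pow_eq_one hXm (by omega)
  have hw : X ^ (t - 1) * a = a + b := by
    apply hu.mul_left_cancel
    rw [← mul_assoc, ← pow_succ', Nat.sub_add_cancel ht1, mul_add, hb2, hb]; ring
  have hwb : X ^ (t - 1) * b = b := by
    have := hiter X 1 b (by rw [hb2, one_mul]) (t - 1)
    rwa [one_pow, one_mul] at this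
  have hwn : ∀ n : ℕ, (X ^ (t - 1)) ^ n * a = a + (n : MonoidAlgebra F H) * b := by
    intro n
    induction n with
    | zero => simp
    | succ n ih =>
      calc (X ^ (t - 1)) ^ (n + 1) * a = X ^ (t - 1) * ((X ^ (t - 1)) ^ n * a) := by ring
        _ = X ^ (t - 1) * a + n * (X ^ (t - 1) * b) := by rw [ih]; ring
        _ = _ := by rw [hw, hwb]; push_cast; ring
  have hmB : (m : MonoidAlgebra F H) = 1 := by
    have := congrArg (algebraMap F (MonoidAlgebra F H)) hmF
    simpa only [map_natCast, map_one] using this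
  have hb0 : b = 0 := by
    have := hwn m
    rw [← pow_mul, mul_comm (t - 1), pow_mul, hXm, one_pow, one_mul, hmB, one_mul] at this
    exact left_eq_add.mp this
  have hXa : X * a = a := by
    apply hinv
    rw [hb, sub_mul] at hb0; exact sub_eq_zero.mp hb0
  obtain ⟨n, hn⟩ := (Submonoid.mem_powers_iff _ _).mp
    ((mem_powers_iff_mem_zpowers).mpr (hgen g))
  have h2 := hiter X 1 a (by rw [hXa, one_mul]) n
  rw [one_pow, one_mul, hXpow, hn] at h2
  have h3 := congrArg (fun z => MonoidAlgebra.coeff z g) h2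
  have h4 : (single g (1 : F) * a).coeff g = a.coeff 1 := by
    rw [coeff_single_mul_apply]; simp
  exact h3.symm.trans h4

open MonoidAlgebra in
theorem aux_main {F : Type*} [Field F] [Finite F] [CharP F 3] {G : Type*} [Group G] [Finite G]
    (x : G) (m t k : ℕ) (ht1 : 1 ≤ t) (hm : m = 3 * k + 1) (hx : x ^ m = 1)
    (ht : x ^ (t ^ 3) = x) (hgcd : Nat.gcd m (t - 1) = 1)
    (hout : ∀ g, g ∉ Subgroup.zpowers x → g * x = x ^ t * g ∨ g * x = x ^ (t ^ 2) * g)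
    [hN : (Subgroup.zpowers x).Normal] :
    (⊥ : Ideal (MonoidAlgebra F G)).jacobson
      ⊓ RingHom.ker (MonoidAlgebra.mapDomainRingHom F
          (QuotientGroup.mk' (Subgroup.zpowers x))) = ⊥ := by
  have hmF : (m : F) = 1 := by
    have h3 : (3 : F) = 0 := by exact_mod_cast CharP.cast_eq_zero F 3
    rw [hm]; push_cast; rw [h3]; ring
  set H := Subgroup.zpowers x with hH
  have : Fintype H := Fintype.ofFinite H
  have hcardF : (Fintype.card H : F) ≠ 0 := by
    intro h0
    have hdvd : Fintype.card H ∣ m := by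
      rw [← Nat.card_eq_fintype_card, Nat.card_zpowers]; exact orderOf_dvd_of_pow_eq_one hx
    obtain ⟨c, hc⟩ := hdvd
    rw [hc] at hmF; push_cast at hmF; rw [h0] at hmF; simp at hmF
  let xi : H := ⟨x, Subgroup.mem_zpowers x⟩
  let iota : MonoidAlgebra F H →+* MonoidAlgebra F G := mapDomainRingHom F H.subtype
  have hinj : Function.Injective iota := mapDomain_injective H.subtype_injective
  let P : MonoidAlgebra F G → MonoidAlgebra F H := comapDomain H.subtype H.subtype_injective
  let X : MonoidAlgebra F G := single x 1
  have hiX : iota (single xi 1) = X := by simp [iota, X, xi]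
  have key : ∀ α : MonoidAlgebra F G,
      X ^ (t ^ 2) * (X ^ t * α - α * X) - (X ^ t * α - α * X) * X
        = iota ((single xi 1 ^ (t ^ 2) - single xi 1) *
      ((single xi 1 ^ t - single xi 1) * P α)) := by
    intro α
    simp only [map_mul, map_sub, map_pow, hiX]
    induction α using MonoidAlgebra.induction_linear with
    | zero =>
      have : P 0 = 0 := comapDomain_zero _ _
      simp [this]
    | add f g hf hg =>
      have : P (f + g) = P f + P g := comapDomain_add _ _ _ _
      rw [this, map_add]
      rw [mul_add (X ^ t - X), mul_add (X ^ (t ^ 2) - X), ← hf, ← hg]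
      simp only [mul_add, add_mul, sub_mul, mul_sub]
      abel
    | single g r =>
      by_cases hg : g ∈ H
      · have hP : iota (P (single g r)) = single g r := by
          have : P (single g r) = single ⟨g, hg⟩ r :=
            comapDomain_single_map H.subtype H.subtype_injective ⟨g, hg⟩ r
          rw [this]; simp [iota]
        have hc : single g r * X = X * single g r := by
          obtain ⟨n, rfl⟩ := hg
          simp only [X, single_mul_single, one_mul, mul_one]
          rw [← zpow_add_one, ← zpow_one_add, add_comm]
        rw [hP]
        have hXX : X * X ^ t = X ^ t * X := (pow_mul_comm' X t).symm
        simp only [sub_mul, mul_sub, mul_assoc, hc]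
        simp only [← mul_assoc, hXX]
        abel
      · have hP : P (single g r) = 0 := by
          apply comapDomain_single_of_not_mem_range
          rintro ⟨h, rfl⟩
          exact hg h.2
        rw [hP]
        simp only [map_zero, mul_zero]
        rcases hout g hg with h | h
        · have hc : single g r * X = X ^ t * single g r := by
            simp [X, single_pow, single_mul_single, h]
          rw [hc]; simp
        · have hc : single g r * X = X ^ (t ^ 2) * single g r := by
            simp [X, single_pow, single_mul_single, h]
          have hXX : X ^ t * X ^ (t ^ 2) = X ^ (t ^ 2) * X ^ t := pow_mul_comm X _ _
          simp only [sub_mul, mul_sub, mul_assoc, hc]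
          simp only [← mul_assoc, hXX]
          simp
  have hsum : ∀ α : MonoidAlgebra F G, (mapDomainRingHom F (QuotientGroup.mk' H) α).coeff 1
      = ∑ h : H, α.coeff h := by
    intro α
    induction α using MonoidAlgebra.induction_linear with
    | zero => simp
    | add f g hf hg =>
      rw [map_add, coeff_add, Finsupp.add_apply, hf, hg, ← Finset.sum_add_distrib]
      rfl
    | single g r =>
      classical
      have hL : (mapDomainRingHom F (QuotientGroup.mk' H) (single g r)).coeff 1
          = if g ∈ H then r else 0 := by
        simp [Finsupp.single_apply]
      rw [hL]
      simp only [coeff_single, Finsupp.single_apply]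
      split_ifs with hg
      · rw [Finset.sum_eq_single ⟨g, hg⟩]
        · simp
        · intro b _ hb
          rw [if_neg]
          rintro rfl
          exact hb rfl
        · simp
      · symm
        apply Finset.sum_eq_zero
        intro b _
        rw [if_neg]
        rintro rfl
        exact hg b.2
  have hone : ∀ α ∈ (⊥ : Ideal (MonoidAlgebra F G)).jacobson
      ⊓ RingHom.ker (MonoidAlgebra.mapDomainRingHom F (QuotientGroup.mk' H)), α.coeff 1 = 0 := by
    rintro α ⟨hJ, hK⟩
    have hT : X ^ (t ^ 2) * (X ^ t * α - α * X) - (X ^ t * α - α * X) * X ∈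
        (⊥ : Ideal (MonoidAlgebra F G)).jacobson := by
      have h1 := Ideal.sub_mem _ (Ideal.mul_mem_left _ (X ^ t) hJ) (Ideal.mul_mem_right X _ hJ)
      exact Ideal.sub_mem _ (Ideal.mul_mem_left _ _ h1) (Ideal.mul_mem_right X _ h1)
    have : Finite (MonoidAlgebra F G) := Finite.of_injective (fun a => (a.coeff : G → F))
      (fun a b h => by ext g; exact congrFun h g)
    obtain ⟨n, hn⟩ := IsArtinianRing.isNilpotent_jacobson_bot (R := MonoidAlgebra F G)
    have hTn := Ideal.pow_mem_pow hT n
    rw [hn, key, ← map_pow] at hTn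
    have hnil := hinj (hTn.trans (map_zero iota).symm)
    have hconst := aux_cyclic (F := F) xi (by
      rintro ⟨_, j, rfl⟩
      exact ⟨j, by ext; simp [xi]⟩) m t k ht1 hm (by ext; simp [xi, hx]) (by ext; simp [xi, ht])
      hgcd (P α) ⟨n, hnil⟩
    have hs := hsum α
    rw [RingHom.mem_ker.mp hK] at hs
    have hc : ∀ h : H, α.coeff h = α.coeff 1 := fun h => hconst h
    simp only [hc] at hs
    simp at hs
    exact hs.resolve_left hcardF
  rw [eq_bot_iff]
  intro α hα
  rw [Ideal.mem_bot]
  ext g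
  have := hone _ (Ideal.mul_mem_left _ (single g⁻¹ 1) hα)
  rw [coeff_single_mul_apply] at this
  simpa using this

/-- For a finite field `F` of characteristic 3, `G = T_{3m}` and `H = ⟨x⟩`, the Jacobson
radical and the relative augmentation ideal `Δ(G,H)` intersect trivially. -/
theorem jacobson_inter_aug (F : Type*) [Field F] [Fintype F] [CharP F 3] (m t k : ℕ)
    (ht1 : 1 ≤ t) (hm : m = 3 * k + 1) (ht : t ^ 3 % m = 1 % m)
    (hgcd : Nat.gcd m (t - 1) = 1) [hN : (Subgroup.zpowers (xg m t)).Normal] :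
    (⊥ : Ideal (MonoidAlgebra F (T3m m t))).jacobson
      ⊓ RingHom.ker (MonoidAlgebra.mapDomainRingHom F
          (QuotientGroup.mk' (Subgroup.zpowers (xg m t)))) = ⊥ := by
  have hx : xg m t ^ m = 1 := PresentedGroup.one_of_mem (by simp [T3mRels])
  have hy : yg m t ^ 3 = 1 := PresentedGroup.one_of_mem (by simp [T3mRels])
  have hxy : (yg m t)⁻¹ * xg m t * yg m t * (xg m t ^ t)⁻¹ = 1 :=
    PresentedGroup.one_of_mem (rels := T3mRels m t)
      (x := (FreeGroup.of 1)⁻¹ * FreeGroup.of 0 * FreeGroup.of 1 * (FreeGroup.of 0 ^ t)⁻¹)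
      (by simp [T3mRels])
  have hcl : Subgroup.closure {xg m t, yg m t} = ⊤ := by
    rw [eq_top_iff, ← PresentedGroup.closure_range_of (T3mRels m t)]
    apply Subgroup.closure_mono
    rintro _ ⟨i, rfl⟩
    fin_cases i
    · exact Or.inl rfl
    · exact Or.inr rfl
  generalize xg m t = x at *
  generalize yg m t = y at *
  have h1 : y⁻¹ * x * y = x ^ t := mul_inv_eq_one.mp hxy
  have h1n : ∀ n : ℕ, y⁻¹ * x ^ n * y = (x ^ n) ^ t := by
    intro n
    have := conj_pow (i := n) (a := y⁻¹) (b := x)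
    rw [inv_inv, h1] at this
    rw [← this, ← pow_mul, ← pow_mul, mul_comm]
  have hy' : y * y = y⁻¹ := by
    rw [eq_inv_iff_mul_eq_one]; simpa [pow_succ] using hy
  have ht3 : x ^ t ^ 3 = x := by
    have hmod : t ^ 3 ≡ 1 [MOD m] := ht
    have := pow_eq_pow_of_modEq hmod hx
    simpa using this
  have hyx1 : y⁻¹ * x = x ^ t * y⁻¹ := by rw [← h1]; group
  have hyx2 : y * x = x ^ (t ^ 2) * y := by
    have h2 := h1n t
    rw [← pow_mul, ← pow_two] at h2
    rw [← h2, ← h1]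
    have : y⁻¹ * (y⁻¹ * x * y) * y * y = (y * y)⁻¹ * x * (y * y) * y := by group
    rw [this, hy']; group
  have hform : ∀ g, ∃ h ∈ Subgroup.zpowers x, g = h ∨ g = h * y ∨ g = h * y⁻¹ := by
    intro g
    have hg : g ∈ Subgroup.zpowers x ⊔ Subgroup.zpowers y := by
      have hle : Subgroup.closure {x, y} ≤ Subgroup.zpowers x ⊔ Subgroup.zpowers y := by
        rw [Subgroup.closure_le]
        rintro _ (rfl | rfl)
        · exact Subgroup.mem_sup_left (Subgroup.mem_zpowers _)
        · exact Subgroup.mem_sup_right (Subgroup.mem_zpowers _)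
      apply hle; rw [hcl]; trivial
    obtain ⟨h, hh, z, ⟨j, rfl⟩, rfl⟩ := Subgroup.mem_sup_of_normal_left.mp hg
    refine ⟨h, hh, ?_⟩
    have hj : y ^ j = y ^ (j % 3) := by
      have := Int.emod_add_mul_ediv j 3
      conv_lhs => rw [← this, zpow_add, zpow_mul]
      have h3 : y ^ (3 : ℤ) = 1 := by exact_mod_cast hy
      rw [h3]; simp
    have : j % 3 = 0 ∨ j % 3 = 1 ∨ j % 3 = 2 := by omega
    simp only [hj]
    rcases this with h | h | h <;> rw [h]
    · left; simp
    · right; left; simp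
    · right; right; rw [← hy', zpow_two]
  have hfx : IsOfFinOrder x := isOfFinOrder_iff_pow_eq_one.mpr ⟨m, by omega, hx⟩
  have hfin : Finite (T3m m t) := by
    have hfz : (Subgroup.zpowers x : Set (T3m m t)).Finite := by
      have := hfx.finite_zpowers
      exact this
    rw [← Set.finite_univ_iff]
    refine ((hfz.union ((hfz.image (· * y)).union (hfz.image (· * y⁻¹))))).subset ?_
    intro g _
    obtain ⟨h, hh, rfl | rfl | rfl⟩ := hform g
    · exact Or.inl hh
    · exact Or.inr (Or.inl ⟨h, hh, rfl⟩)
    · exact Or.inr (Or.inr ⟨h, hh, rfl⟩)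
  refine aux_main x m t k ht1 hm hx ht3 hgcd ?_
  intro g hg
  obtain ⟨h, hh, rfl | rfl | rfl⟩ := hform g
  · exact absurd hh hg
  · right
    obtain ⟨n, rfl⟩ := hh
    have hc : x ^ n * x ^ (t ^ 2) = x ^ (t ^ 2) * x ^ n := (((Commute.refl x).pow_right _).zpow_left n).eq
    simp only
    rw [mul_assoc, hyx2, ← mul_assoc, hc, mul_assoc]
  · left
    obtain ⟨n, rfl⟩ := hh
    have hc : x ^ n * x ^ t = x ^ t * x ^ n := (((Commute.refl x).pow_right _).zpow_left n).eq
    simp only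
    rw [mul_assoc, hyx1, ← mul_assoc, hc, mul_assoc]
end

section
/- Let F be a finite field of characteristic 3, G = T_{3m} with m = 3k+1, and H = ⟨x⟩. Then the augmentation ideal decomposes as a direct sum Δ(G) = J(FG) ⊕ Δ(G,H). -/
section CoreAlgebra

variable {F A : Type*} [Field F] [Ring A] [Algebra F A]

/-- A set of orbit representatives for multiplication by `τ` on the nonzero residues. -/
noncomputable def orbRep {m : ℕ} (τ : ZMod m) (i : ZMod m) : F :=
  if i.val < (τ * i).val ∧ i.val < (τ * (τ * i)).val then -1 else 0

lemma orbRep_sum {m : ℕ} [NeZero m] (τ : ZMod m) (h3 : τ * τ * τ = 1) (hu : IsUnit (τ - 1))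
    (i : ZMod m) (hi : i ≠ 0) :
    (orbRep τ i : F) + orbRep τ (τ * i) + orbRep τ (τ * (τ * i)) = -1 := by
  have h3i : τ * (τ * (τ * i)) = i := by
    rw [← mul_assoc, ← mul_assoc, h3, one_mul]
  have key : ∀ j : ZMod m, τ * j = j → j = 0 := by
    intro j hj
    have : (τ - 1) * j = 0 := by rw [sub_mul, hj, one_mul, sub_self]
    exact (hu.mul_right_eq_zero).1 this
  have h1 : (τ * i).val ≠ i.val := fun h => hi (key i (ZMod.val_injective m h))
  have h2 : (τ * (τ * i)).val ≠ i.val := by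
    intro h
    have h' := ZMod.val_injective m h
    have : τ * i = i := by
      have := congrArg (τ * ·) h'
      beta_reduce at this
      rw [h3i] at this
      exact this.symm
    exact hi (key i this)
  have h4 : (τ * (τ * i)).val ≠ (τ * i).val := by
    intro h
    have h' := key _ (ZMod.val_injective m h)
    rw [h', mul_zero, mul_zero] at h3i
    exact hi h3i.symm
  unfold orbRep
  rw [h3i]
  split_ifs <;> first | omega | simp

lemma orbRep_zero {m : ℕ} (τ : ZMod m) : (orbRep τ 0 : F) = 0 := by
  simp [orbRep]

/-- The Maschke-type argument. -/
lemma core_zero {m : ℕ} [NeZero m] (hmF : (m : F) = 1) (τ : ZMod m) (h3 : τ * τ * τ = 1)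
    (hu : IsUnit (τ - 1)) (X : ZMod m → A) (Y : A) (X0 : X 0 = 1)
    (Xadd : ∀ i j, X (i + j) = X i * X j) (Y3 : Y * Y * Y = 1)
    (YX : ∀ i, Y * Y * X i = X (τ * i) * (Y * Y))
    (gen : ∀ S : Submodule F A, 1 ∈ S → (∀ a ∈ S, X 1 * a ∈ S) → (∀ a ∈ S, Y * a ∈ S) → S = ⊤)
    (N : Ideal A) (hN : N ≤ (⊥ : Ideal A).jacobson) (hE : ∀ v ∈ N, (∑ i, X i) * v = 0) :
    N = ⊥ := by
  classical
  have YX1 : ∀ i, Y * X i = X (τ * (τ * i)) * Y := by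
    intro i
    have e : Y = (Y * Y) * (Y * Y) := by
      calc Y = (Y * Y * Y) * Y := by rw [Y3, one_mul]
        _ = _ := by simp only [mul_assoc]
    calc Y * X i = (Y * Y) * ((Y * Y) * X i) := by
          conv_lhs => rw [e]
          simp only [mul_assoc]
      _ = ((Y * Y) * X (τ * i)) * (Y * Y) := by rw [YX]; simp only [mul_assoc]
      _ = X (τ * (τ * i)) * ((Y * Y) * (Y * Y)) := by rw [YX]; simp only [mul_assoc]
      _ = _ := by rw [← e]
  have h3i : ∀ i, τ * (τ * (τ * i)) = i := by
    intro i
    rw [← mul_assoc, ← mul_assoc, h3, one_mul]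
  let c : A := ∑ i, (orbRep τ i : F) • X i
  have Xc : ∀ i, X i * c = c * X i := by
    intro i
    simp only [c, Finset.mul_sum, Finset.sum_mul, mul_smul_comm, smul_mul_assoc, ← Xadd, add_comm]
  let μ : Equiv.Perm (ZMod m) :=
    ⟨fun i => τ * i, fun i => τ * (τ * i), fun i => h3i i, fun i => h3i i⟩
  have c1 : Y * Y * c * Y = ∑ i, (orbRep τ (τ * (τ * i)) : F) • X i := by
    have : ∀ i, Y * Y * X i * Y = X (τ * i) := by
      intro i
      rw [YX, mul_assoc, Y3, mul_one]
    simp only [c, Finset.mul_sum, Finset.sum_mul, mul_smul_comm, smul_mul_assoc, this]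
    refine Fintype.sum_equiv μ _ _ fun i => ?_
    simp only [μ, Equiv.coe_fn_mk, h3i]
  have c2 : Y * c * (Y * Y) = ∑ i, (orbRep τ (τ * i) : F) • X i := by
    have : ∀ i, Y * X i * (Y * Y) = X (τ * (τ * i)) := by
      intro i
      rw [YX1, mul_assoc, ← mul_assoc Y Y Y, Y3, mul_one]
    simp only [c, Finset.mul_sum, Finset.sum_mul, mul_smul_comm, smul_mul_assoc, this]
    refine Fintype.sum_equiv μ.symm _ _ fun i => ?_
    simp only [μ, Equiv.symm_mk, Equiv.coe_fn_mk, h3i]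
  have hu1 : c + Y * c * (Y * Y) + Y * Y * c * Y = 1 - ∑ i, X i := by
    rw [c1, c2, ← Finset.sum_add_distrib, ← Finset.sum_add_distrib]
    rw [← Finset.add_sum_erase _ _ (Finset.mem_univ (0 : ZMod m)),
      ← Finset.add_sum_erase _ X (Finset.mem_univ (0 : ZMod m))]
    simp only [mul_zero, orbRep_zero, X0, zero_smul, add_zero, zero_add]
    rw [sub_add_cancel_left, ← Finset.sum_neg_distrib]
    refine Finset.sum_congr rfl fun i hi => ?_
    rw [← add_smul, ← add_smul, orbRep_sum τ h3 hu i (Finset.ne_of_mem_erase hi)]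
    simp
  obtain ⟨p0, hp0⟩ := (N.restrictScalars F).subtype.exists_leftInverse_of_injective
    (Submodule.ker_subtype _)
  let p : A →ₗ[F] A := (N.restrictScalars F).subtype ∘ₗ p0
  have pmem : ∀ v, p v ∈ N := fun v => (p0 v).2
  have pid : ∀ v ∈ N, p v = v := by
    intro v hv
    have := LinearMap.congr_fun hp0 ⟨v, hv⟩
    exact congrArg Subtype.val this
  let Q : A → A := fun v => ∑ i, X i * (c * p (X (-i) * v))
  have Qadd : ∀ v w, Q (v + w) = Q v + Q w := by
    intro v w
    simp only [Q, mul_add, map_add, Finset.sum_add_distrib]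
  have Qsmul : ∀ (r : F) v, Q (r • v) = r • Q v := by
    intro r v
    simp only [Q, mul_smul_comm, map_smul, Finset.smul_sum]
  have QX : ∀ a v, Q (X a * v) = X a * Q v := by
    intro a v
    simp only [Q, Finset.mul_sum]
    refine Fintype.sum_equiv (Equiv.addLeft (-a)) _ _ fun i => ?_
    simp only [Equiv.coe_addLeft]
    rw [← mul_assoc (X a), ← Xadd, ← mul_assoc (X (-i)), ← Xadd]
    rw [show a + (-a + i) = i by ring, show -(-a + i) = -i + a by ring]
  have Qmem : ∀ v, Q v ∈ N := fun v =>
    N.sum_mem fun i _ => N.mul_mem_left _ (N.mul_mem_left _ (pmem _))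
  have Qid : ∀ v ∈ N, Q v = c * v := by
    intro v hv
    have : ∀ i, X i * (c * p (X (-i) * v)) = c * v := by
      intro i
      rw [pid _ (N.mul_mem_left _ hv), ← mul_assoc, Xc, mul_assoc, ← mul_assoc (X i), ← Xadd,
        add_neg_cancel, X0, one_mul]
    simp only [Q, this, Finset.sum_const, Finset.card_univ, ZMod.card]
    rw [← Nat.cast_smul_eq_nsmul F, hmF, one_smul]
  let P : A → A := fun v => Q v + Y * Q (Y * Y * v) + Y * Y * Q (Y * v)
  have PY : ∀ v, P (Y * v) = Y * P v := by
    intro v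
    have e1 : Y * Y * (Y * v) = v := by rw [← mul_assoc, Y3, one_mul]
    have e2 : ∀ w, Y * (Y * (Y * w)) = w := by
      intro w; rw [← mul_assoc, ← mul_assoc, Y3, one_mul]
    simp only [P, e1, mul_add]
    simp only [mul_assoc, e2]
    abel
  have PX : ∀ a v, P (X a * v) = X a * P v := by
    intro a v
    simp only [P, mul_add]
    have e1 : Y * Y * (X a * v) = X (τ * a) * (Y * Y * v) := by
      rw [← mul_assoc, YX, mul_assoc]
    have e2 : Y * (X a * v) = X (τ * (τ * a)) * (Y * v) := by
      rw [← mul_assoc, YX1, mul_assoc]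
    rw [QX, e1, e2, QX, QX, ← mul_assoc Y (X _), YX1, h3i, ← mul_assoc (Y * Y) (X _), YX, h3i]
    simp only [mul_assoc]
  have Padd : ∀ v w, P (v + w) = P v + P w := by
    intro v w
    simp only [P, mul_add, Qadd]
    abel
  have Psmul : ∀ (r : F) v, P (r • v) = r • P v := by
    intro r v
    simp only [P, mul_smul_comm, Qsmul, smul_add]
  have Pall : ∀ a v, P (a * v) = a * P v := by
    let S : Submodule F A :=
      { carrier := {a | ∀ v, P (a * v) = a * P v}
        add_mem' := by
          intro a b ha hb v
          rw [add_mul, Padd, ha, hb, add_mul]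
        zero_mem' := by
          intro v
          have := Psmul 0 0
          simpa using this
        smul_mem' := by
          intro r a ha v
          rw [smul_mul_assoc, Psmul, ha, smul_mul_assoc] }
    have hS : S = ⊤ := by
      apply gen S
      · intro v; simp
      · intro a ha v
        rw [mul_assoc, PX, ha, mul_assoc]
      · intro a ha v
        rw [mul_assoc, PY, ha, mul_assoc]
    intro a
    have : a ∈ S := hS ▸ Submodule.mem_top
    exact this
  have Pmem : ∀ v, P v ∈ N := fun v =>
    N.add_mem (N.add_mem (Qmem _) (N.mul_mem_left _ (Qmem _))) (N.mul_mem_left _ (Qmem _))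
  have Pid : ∀ v ∈ N, P v = v := by
    intro v hv
    simp only [P]
    rw [Qid v hv, Qid _ (N.mul_mem_left _ hv), Qid _ (N.mul_mem_left _ hv)]
    have : c * v + Y * (c * (Y * Y * v)) + Y * Y * (c * (Y * v))
        = (c + Y * c * (Y * Y) + Y * Y * c * Y) * v := by
      simp only [add_mul, mul_assoc]
    rw [this, hu1, sub_mul, hE v hv, one_mul, sub_zero]
  have hPv : ∀ v ∈ N, v * P 1 = v := by
    intro v hv
    rw [← Pall, mul_one, Pid v hv]
  have hf : P 1 = 0 := by
    have hJ := hN (Pmem 1)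
    rw [Ideal.mem_jacobson_iff] at hJ
    obtain ⟨z, hz⟩ := hJ (-1)
    rw [Ideal.mem_bot] at hz
    have h1 := congrArg (· * P 1) hz
    simp only [sub_mul, add_mul, zero_mul, mul_assoc, hPv _ (Pmem 1)] at h1
    simp at h1
    exact h1
  rw [eq_bot_iff]
  intro v hv
  rw [Ideal.mem_bot, ← hPv v hv, hf, mul_zero]

/-- Nilpotency gives membership in the radical. -/
lemma core_nil [CharP F 3] (Y e : A) (Y3 : Y * Y * Y = 1)
    (hc : ∀ a, e * a = a * e) (q : Polynomial F) (hq : q.eval 1 = 0) :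
    (e * Polynomial.aeval Y q) ^ 3 = 0 := by
  obtain ⟨r, rfl⟩ := Polynomial.dvd_iff_isRoot.2 hq
  have h0 : (Polynomial.aeval Y ((Polynomial.X - Polynomial.C (1 : F)) * r)) ^ 3 = 0 := by
    rw [← map_pow, mul_pow]
    have : (Polynomial.X - Polynomial.C (1 : F)) ^ 3 = Polynomial.X ^ 3 - 1 := by
      have : Fact (Nat.Prime 3) := ⟨Nat.prime_three⟩
      rw [sub_pow_char]
      simp
    rw [this, map_mul, map_sub, map_pow, Polynomial.aeval_X, map_one,
      show Y ^ 3 = 1 by rw [pow_succ, pow_two, Y3], sub_self, zero_mul]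
  have hcomm : Commute e (Polynomial.aeval Y ((Polynomial.X - Polynomial.C (1 : F)) * r)) := hc _
  rw [hcomm.mul_pow, h0, mul_zero]

end CoreAlgebra

section GroupPart

lemma xg_pow (m t : ℕ) : xg m t ^ m = 1 := by
  have : (FreeGroup.of 0 ^ m : FreeGroup (Fin 2)) ∈ T3mRels m t := by simp [T3mRels]
  simpa [xg, yg, PresentedGroup.of] using PresentedGroup.one_of_mem this

lemma yg_pow (m t : ℕ) : yg m t * yg m t * yg m t = 1 := by
  have : (FreeGroup.of 1 ^ 3 : FreeGroup (Fin 2)) ∈ T3mRels m t := by simp [T3mRels]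
  have h : yg m t ^ 3 = 1 := by simpa [xg, yg, PresentedGroup.of] using PresentedGroup.one_of_mem this
  rw [← h, pow_succ, pow_two]

lemma yg_conj (m t : ℕ) : (yg m t)⁻¹ * xg m t * yg m t = xg m t ^ t := by
  have : ((FreeGroup.of 1)⁻¹ * FreeGroup.of 0 * FreeGroup.of 1 * (FreeGroup.of 0 ^ t)⁻¹ :
    FreeGroup (Fin 2)) ∈ T3mRels m t := by simp [T3mRels]
  have h : (yg m t)⁻¹ * xg m t * yg m t * (xg m t ^ t)⁻¹ = 1 := by
    simpa [xg, yg, PresentedGroup.of] using PresentedGroup.one_of_mem this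
  exact mul_inv_eq_one.1 h

lemma yg_xg (m t n : ℕ) : yg m t * yg m t * xg m t ^ n = xg m t ^ (t * n) * (yg m t * yg m t) := by
  have hy : yg m t * yg m t = (yg m t)⁻¹ := eq_inv_of_mul_eq_one_left (yg_pow m t)
  have : ((yg m t)⁻¹ * xg m t * yg m t) ^ n = (yg m t)⁻¹ * xg m t ^ n * yg m t := by
    have := conj_pow (i := n) (a := (yg m t)⁻¹) (b := xg m t)
    simpa using this
  rw [hy, pow_mul, ← yg_conj, this]
  group

lemma T3m_induction (m t : ℕ) (hm : 0 < m) (C : T3m m t → Prop) (h1 : C 1)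
    (hx : ∀ g, C g → C (xg m t * g)) (hy : ∀ g, C g → C (yg m t * g)) (g : T3m m t) : C g := by
  have hxn : ∀ n g, C g → C (xg m t ^ n * g) := by
    intro n
    induction n with
    | zero => intro g hg; simpa using hg
    | succ n ih => intro g hg; rw [pow_succ', mul_assoc]; exact hx _ (ih _ hg)
  have key : ∀ g : T3m m t, ∀ h, C h → C (g * h) := by
    intro g
    have hg : g ∈ Subgroup.closure (Set.range (PresentedGroup.of (rels := T3mRels m t))) := by
      rw [PresentedGroup.closure_range_of]; trivial
    induction hg using Subgroup.closure_induction'' with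
    | one => intro h hh; simpa using hh
    | mul a b _ _ ha hb => intro h hh; rw [mul_assoc]; exact ha _ (hb _ hh)
    | mem a ha =>
      obtain ⟨i, rfl⟩ := ha
      fin_cases i
      · exact hx
      · exact hy
    | inv_mem a ha =>
      obtain ⟨i, rfl⟩ := ha
      fin_cases i
      · intro h hh
        have : (xg m t)⁻¹ = xg m t ^ (m - 1) := by
          rw [inv_eq_iff_mul_eq_one, ← pow_succ', Nat.sub_add_cancel hm, xg_pow]
        change C ((xg m t)⁻¹ * h)
        rw [this]
        exact hxn _ _ hh
      · intro h hh
        have : (yg m t)⁻¹ = yg m t * yg m t :=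
          (eq_inv_of_mul_eq_one_left (yg_pow m t)).symm
        change C ((yg m t)⁻¹ * h)
        rw [this, mul_assoc]
        exact hy _ (hy _ hh)
  simpa using key g 1 h1

end GroupPart

/-- For a finite field `F` of characteristic 3, `G = T_{3m}` and `H = ⟨x⟩`, the augmentation
ideal decomposes as `Δ(G) = J(FG) ⊕ Δ(G,H)`. -/
theorem aug_decomposition (F : Type*) [Field F] [Fintype F] [CharP F 3] (m t k : ℕ)
    (ht1 : 1 ≤ t) (hm : m = 3 * k + 1) (ht : t ^ 3 % m = 1 % m)
    (hgcd : Nat.gcd m (t - 1) = 1) [hN : (Subgroup.zpowers (xg m t)).Normal] :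
    letI J := (⊥ : Ideal (MonoidAlgebra F (T3m m t))).jacobson
    letI Δ' := RingHom.ker (MonoidAlgebra.mapDomainRingHom F
        (QuotientGroup.mk' (Subgroup.zpowers (xg m t))))
    letI Δ := RingHom.ker (MonoidAlgebra.mapDomainRingHom F
        (QuotientGroup.mk' (⊤ : Subgroup (T3m m t))))
    J ⊓ Δ' = ⊥ ∧ J ⊔ Δ' = Δ := by
  classical
  have hm0 : 0 < m := by omega
  have : NeZero m := ⟨hm0.ne'⟩
  have h30 : (3 : F) = 0 := by exact_mod_cast CharP.cast_eq_zero F 3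
  have hmF : (m : F) = 1 := by rw [hm]; push_cast; rw [h30]; simp
  let o : T3m m t →* MonoidAlgebra F (T3m m t) := MonoidAlgebra.of F (T3m m t)
  let τ : ZMod m := (t : ZMod m)
  have h3 : τ * τ * τ = 1 := by
    have : ((t ^ 3 : ℕ) : ZMod m) = ((1 : ℕ) : ZMod m) := (ZMod.natCast_eq_natCast_iff _ _ _).2 ht
    push_cast at this
    rw [← this]; ring
  have hu : IsUnit (τ - 1) := by
    have : IsUnit ((t - 1 : ℕ) : ZMod m) :=
      (ZMod.isUnit_iff_coprime _ _).2 (Nat.Coprime.symm hgcd)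
    rwa [Nat.cast_sub ht1, Nat.cast_one] at this
  let X : ZMod m → MonoidAlgebra F (T3m m t) := fun i => o (xg m t ^ i.val)
  let Y : MonoidAlgebra F (T3m m t) := o (yg m t)
  have X0 : X 0 = 1 := by simp [X]
  have Xn : ∀ n : ℕ, X (n : ZMod m) = o (xg m t ^ n) := by
    intro n
    simp only [X, ZMod.val_natCast]
    rw [← pow_eq_pow_mod n (xg_pow m t)]
  have Xn' : ∀ i : ZMod m, ∃ n : ℕ, (n : ZMod m) = i := fun i => ⟨i.val, ZMod.natCast_zmod_val i⟩
  have Xadd : ∀ i j, X (i + j) = X i * X j := by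
    intro i j
    obtain ⟨a, rfl⟩ := Xn' i
    obtain ⟨b, rfl⟩ := Xn' j
    rw [← Nat.cast_add, Xn, Xn, Xn, pow_add, map_mul]
  have Y3 : Y * Y * Y = 1 := by
    simp only [Y, ← map_mul, yg_pow, map_one]
  have YX : ∀ i, Y * Y * X i = X (τ * i) * (Y * Y) := by
    intro i
    obtain ⟨a, rfl⟩ := Xn' i
    simp only [τ]
    rw [← Nat.cast_mul, Xn, Xn]
    simp only [Y, ← map_mul, yg_xg]
  have X1 : X 1 = o (xg m t) := by
    have := Xn 1
    simpa using this
  have lin : ∀ (S : Submodule F (MonoidAlgebra F (T3m m t))), (∀ g, o g ∈ S) → S = ⊤ := by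
    intro S hS
    rw [eq_top_iff]
    intro a _
    induction a using MonoidAlgebra.induction_linear with
    | zero => exact S.zero_mem
    | add f g hf hg => exact S.add_mem (hf trivial) (hg trivial)
    | single g r =>
      have := S.smul_mem r (hS g)
      simpa [o] using this
  have gen : ∀ S : Submodule F (MonoidAlgebra F (T3m m t)), 1 ∈ S → (∀ a ∈ S, X 1 * a ∈ S) →
      (∀ a ∈ S, Y * a ∈ S) → S = ⊤ := by
    intro S h1 hx hy
    apply lin
    refine T3m_induction m t hm0 _ (by simpa using h1) ?_ ?_
    · intro g hg
      rw [map_mul, ← X1]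
      exact hx _ hg
    · intro g hg
      rw [map_mul]
      exact hy _ hg
  let E : MonoidAlgebra F (T3m m t) := ∑ i, X i
  have EX : ∀ a, E * X a = E := by
    intro a
    simp only [E, Finset.sum_mul, ← Xadd]
    exact Fintype.sum_equiv (Equiv.addRight a) _ _ fun i => rfl
  have XE : ∀ a, X a * E = E := by
    intro a
    simp only [E, Finset.mul_sum, ← Xadd]
    exact Fintype.sum_equiv (Equiv.addLeft a) _ _ fun i => rfl
  have EE : E * E = E := by
    have : E * E = ∑ i, E * X i := by
      rw [← Finset.mul_sum]
    rw [this]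
    simp only [EX, Finset.sum_const, Finset.card_univ, ZMod.card]
    rw [← Nat.cast_smul_eq_nsmul F, hmF, one_smul]
  have YYE : Y * Y * E = E * (Y * Y) := by
    simp only [E, Finset.mul_sum, Finset.sum_mul, YX]
    have h3i : ∀ i, τ * (τ * (τ * i)) = i := by
      intro i
      rw [← mul_assoc, ← mul_assoc, h3, one_mul]
    let μ : Equiv.Perm (ZMod m) :=
      ⟨fun i => τ * i, fun i => τ * (τ * i), fun i => h3i i, fun i => h3i i⟩
    exact Fintype.sum_equiv μ _ _ fun i => rfl
  have YE : Y * E = E * Y := by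
    calc Y * E = Y * (E * (Y * Y * Y)) := by rw [Y3, mul_one]
      _ = Y * ((E * (Y * Y)) * Y) := by simp only [mul_assoc]
      _ = (Y * Y * Y) * E * Y := by rw [← YYE]; simp only [mul_assoc]
      _ = E * Y := by rw [Y3, one_mul]
  have Ec : ∀ a, E * a = a * E := by
    let S : Submodule F (MonoidAlgebra F (T3m m t)) :=
      { carrier := {a | E * a = a * E}
        add_mem' := by
          intro a b ha hb
          simp only [Set.mem_ofPred_eq] at *
          rw [mul_add, ha, hb, add_mul]
        zero_mem' := by simp
        smul_mem' := by
          intro r a ha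
          simp only [Set.mem_ofPred_eq] at *
          rw [mul_smul_comm, ha, smul_mul_assoc] }
    have hS : S = ⊤ := by
      apply gen S
      · change E * 1 = 1 * E
        simp
      · intro a ha
        change E * (X 1 * a) = X 1 * a * E
        have ha : E * a = a * E := ha
        rw [mul_assoc, ← ha, ← mul_assoc, ← mul_assoc, EX, XE]
      · intro a ha
        change E * (Y * a) = Y * a * E
        have ha : E * a = a * E := ha
        rw [mul_assoc, ← ha, ← mul_assoc, ← mul_assoc, YE]
    intro a
    have : a ∈ S := hS ▸ Submodule.mem_top
    exact this
  let π := MonoidAlgebra.mapDomainRingHom F (QuotientGroup.mk' (Subgroup.zpowers (xg m t)))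
  let ρ := MonoidAlgebra.mapDomainRingHom F (QuotientGroup.mk' (⊤ : Subgroup (T3m m t)))
  have hE0 : ∀ v, π v = 0 → E * v = 0 := by
    let L : MonoidAlgebra F (T3m m t ⧸ Subgroup.zpowers (xg m t)) →+ MonoidAlgebra F (T3m m t) :=
      { toFun := fun z => z.coeff.sum fun q r => r • (E * o q.out)
        map_zero' := by simp
        map_add' := by
          intro a b
          rw [MonoidAlgebra.coeff_add, Finsupp.sum_add_index'] <;> simp [add_smul] }
    have hL : ∀ v, L (π v) = E * v := by
      intro v
      induction v using MonoidAlgebra.induction_linear with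
      | zero => simp
      | add f g hf hg => rw [map_add, map_add, hf, hg, mul_add]
      | single g r =>
        have h1 : π (MonoidAlgebra.single g r) =
            MonoidAlgebra.single (QuotientGroup.mk g) r := by
          simp [π]
        have h2 : E * o (QuotientGroup.mk g : T3m m t ⧸ Subgroup.zpowers (xg m t)).out = E * o g := by
          obtain ⟨h, hh⟩ := QuotientGroup.mk_out_eq_mul (Subgroup.zpowers (xg m t)) g
          rw [hh, map_mul, ← mul_assoc, Ec, mul_assoc]
          obtain ⟨n, hn⟩ := (isOfFinOrder_iff_pow_eq_one.2
            ⟨m, hm0, xg_pow m t⟩).mem_powers_iff_mem_zpowers.2 h.2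
          simp only at hn
          rw [← hn, ← Xn, EX]
        rw [h1]
        have h3 : ∀ z, L z = z.coeff.sum fun q r => r • (E * o q.out) := fun z => rfl
        rw [h3, MonoidAlgebra.coeff_single, Finsupp.sum_single_index (by simp), h2, ← mul_smul_comm]
        simp [o]
    intro v hv
    rw [← hL, hv, map_zero]
  have πE : π (1 - E) = 0 := by
    have : ∀ i, π (X i) = 1 := by
      intro i
      have hq : (QuotientGroup.mk (xg m t ^ i.val) : T3m m t ⧸ Subgroup.zpowers (xg m t)) = 1 :=
        (QuotientGroup.eq_one_iff _).2 (Subgroup.npow_mem_zpowers _ _)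
      have : π (X i) = MonoidAlgebra.single
          (QuotientGroup.mk (xg m t ^ i.val) : T3m m t ⧸ Subgroup.zpowers (xg m t)) 1 := by
        simp [π, X, o]
      rw [this, hq]
      rfl
    have hs : π E = 1 := by
      simp only [E, map_sum, this, Finset.sum_const, Finset.card_univ, ZMod.card]
      rw [← Nat.cast_smul_eq_nsmul F, hmF, one_smul]
    rw [map_sub, hs, map_one, sub_self]
  let ε : MonoidAlgebra F (T3m m t) →ₐ[F] F := MonoidAlgebra.lift F F (T3m m t) 1
  have εo : ∀ g, ε (o g) = 1 := by
    intro g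
    simp [ε, o]
  have ρε : ∀ v, ρ v = MonoidAlgebra.single 1 (ε v) := by
    intro v
    induction v using MonoidAlgebra.induction_linear with
    | zero => simp
    | add f g hf hg => rw [map_add, map_add, hf, hg, MonoidAlgebra.single_add]
    | single g r =>
      have h1 : ρ (MonoidAlgebra.single g r) = MonoidAlgebra.single (QuotientGroup.mk g) r := by
        simp [ρ]
      rw [h1, (QuotientGroup.eq_one_iff _).2 (Subgroup.mem_top g)]
      simp [ε]
  have ρ0 : ∀ v, ρ v = 0 ↔ ε v = 0 := by
    intro v
    rw [ρε, MonoidAlgebra.single_eq_zero]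
  have επ : ∀ v, ∃ f : MonoidAlgebra F (T3m m t ⧸ Subgroup.zpowers (xg m t)) →ₐ[F] F, ε v = f (π v) := by
    intro v
    refine ⟨MonoidAlgebra.lift F F _ 1, ?_⟩
    induction v using MonoidAlgebra.induction_linear with
    | zero => simp
    | add f g hf hg => rw [map_add, map_add, hf, hg, map_add]
    | single g r => simp [ε, π]
  have hq : ∀ w, ∃ q : Polynomial F, E * w = E * Polynomial.aeval Y q ∧ q.eval 1 = ε w := by
    let S : Submodule F (MonoidAlgebra F (T3m m t)) :=
      { carrier := {w | ∃ q : Polynomial F, E * w = E * Polynomial.aeval Y q ∧ q.eval 1 = ε w}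
        add_mem' := by
          rintro a b ⟨p, hp, hp'⟩ ⟨q, hq, hq'⟩
          exact ⟨p + q, by rw [mul_add, hp, hq, map_add, mul_add],
            by rw [Polynomial.eval_add, hp', hq', map_add]⟩
        zero_mem' := ⟨0, by simp⟩
        smul_mem' := by
          rintro r a ⟨p, hp, hp'⟩
          exact ⟨r • p, by rw [mul_smul_comm, hp, map_smul, mul_smul_comm],
            by rw [Polynomial.eval_smul, hp', map_smul]⟩ }
    have hS : S = ⊤ := by
      apply gen S
      · exact ⟨1, by simp⟩
      · rintro a ⟨p, hp, hp'⟩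
        exact ⟨p, by rw [← mul_assoc, EX, hp], by rw [map_mul, X1, εo, one_mul, hp']⟩
      · rintro a ⟨p, hp, hp'⟩
        refine ⟨Polynomial.X * p, ?_, ?_⟩
        · rw [map_mul, Polynomial.aeval_X, ← mul_assoc, ← mul_assoc, ← YE, mul_assoc, mul_assoc, hp]
        · rw [Polynomial.eval_mul, Polynomial.eval_X, map_mul, εo, hp']
    intro a
    have : a ∈ S := hS ▸ Submodule.mem_top
    exact this
  have hJE : ∀ v, ε v = 0 → E * v ∈ (⊥ : Ideal (MonoidAlgebra F (T3m m t))).jacobson := by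
    intro v hv
    rw [Ideal.mem_jacobson_iff]
    intro a
    obtain ⟨q, hq1, hq2⟩ := hq (a * v)
    have hn : IsNilpotent (a * (E * v)) := by
      refine ⟨3, ?_⟩
      rw [← mul_assoc, ← Ec, mul_assoc, hq1]
      exact core_nil Y E Y3 Ec q (by rw [hq2, map_mul, hv, mul_zero])
    obtain ⟨u, hu⟩ := hn.isUnit_one_add
    refine ⟨(u⁻¹ : (MonoidAlgebra F (T3m m t))ˣ), ?_⟩
    have : ((u⁻¹ : (MonoidAlgebra F (T3m m t))ˣ) : MonoidAlgebra F (T3m m t)) * (1 + a * (E * v)) = 1 := by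
      rw [← hu, Units.inv_mul]
    rw [Ideal.mem_bot, ← this]
    simp only [mul_add, mul_one, mul_assoc]
    abel
  have hJε : ∀ v ∈ (⊥ : Ideal (MonoidAlgebra F (T3m m t))).jacobson, ε v = 0 := by
    intro v hv
    by_contra h
    rw [Ideal.mem_jacobson_iff] at hv
    obtain ⟨z, hz⟩ := hv (algebraMap F _ (-(ε v)⁻¹))
    rw [Ideal.mem_bot] at hz
    have := congrArg ε hz
    simp only [map_sub, map_add, map_mul, map_one, map_zero, AlgHom.commutes] at this
    rw [mul_assoc, Algebra.algebraMap_self, RingHom.id_apply, neg_mul, inv_mul_cancel₀ h] at this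
    simp at this
  refine ⟨?_, ?_⟩
  · refine core_zero hmF τ h3 hu X Y X0 Xadd Y3 YX gen _ inf_le_left ?_
    intro v hv
    exact hE0 v ((RingHom.mem_ker).1 hv.2)
  · apply le_antisymm
    · refine sup_le ?_ ?_
      · intro v hv
        exact (RingHom.mem_ker).2 ((ρ0 v).2 (hJε v hv))
      · intro v hv
        refine (RingHom.mem_ker).2 ((ρ0 v).2 ?_)
        obtain ⟨f, hf⟩ := επ v
        rw [hf, show π v = 0 from (RingHom.mem_ker).1 hv, map_zero]
    · intro v hv
      have hv' : ε v = 0 := (ρ0 v).1 ((RingHom.mem_ker).1 hv)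
      have : v = E * v + (1 - E) * v := by rw [sub_mul, one_mul]; abel
      rw [this]
      refine Submodule.add_mem_sup (hJE v hv') ((RingHom.mem_ker).2 ?_)
      change π ((1 - E) * v) = 0
      rw [map_mul, πE, zero_mul]
end

section
/- Let F be a finite field of characteristic 3 and G = T_{3m} with m = 3k+1, with conjugacy classes {1}, C_1, …, C_k (each of size 3, contained in ⟨x⟩), ⟨x⟩y, and ⟨x⟩y^{-1}. Then the center of Δ(G,⟨x⟩) is the F-span of the class sums Ĉ_1, …, Ĉ_k, and in particular dim_F Z(Δ(G,⟨x⟩)) = k. -/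
section General

variable {F : Type*} [Field F] {G : Type*} [Group G] (N : Subgroup G) [N.Normal]

lemma aux_coeff_map [Fintype N] (a : MonoidAlgebra F G) (g : G) :
    (MonoidAlgebra.mapDomainRingHom F (QuotientGroup.mk' N) a).coeff (QuotientGroup.mk' N g)
      = ∑ n : N, a.coeff (g * n) := by
  classical
  induction a using MonoidAlgebra.induction_linear with
  | zero => simp
  | add x y hx hy =>
    rw [map_add, MonoidAlgebra.coeff_add, Finsupp.add_apply, hx, hy, ← Finset.sum_add_distrib]
    rfl
  | single h r =>
    simp only [MonoidAlgebra.mapDomainRingHom_apply, MonoidAlgebra.mapDomain_single,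
      MonoidAlgebra.coeff_single, Finsupp.single_apply]
    by_cases hh : (QuotientGroup.mk' N h) = QuotientGroup.mk' N g
    · rw [if_pos hh]
      have hmem : g⁻¹ * h ∈ N := QuotientGroup.eq.mp hh.symm
      rw [Finset.sum_eq_single (⟨g⁻¹ * h, hmem⟩ : N)]
      · simp
      · intro b _ hb
        rw [if_neg]
        rintro rfl
        apply hb
        ext
        simp
      · simp
    · rw [if_neg hh, Finset.sum_eq_zero]
      intro n _
      rw [if_neg]
      rintro rfl
      apply hh
      simp

lemma aux_central [Fintype N] (hcN : (Fintype.card N : F) = 1) (a : MonoidAlgebra F G)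
    (ha : MonoidAlgebra.mapDomainRingHom F (QuotientGroup.mk' N) a = 0)
    (hc : ∀ b, MonoidAlgebra.mapDomainRingHom F (QuotientGroup.mk' N) b = 0 → a * b = b * a)
    (b : MonoidAlgebra F G) : a * b = b * a := by
  set p := MonoidAlgebra.mapDomainRingHom F (QuotientGroup.mk' N) with hp
  set e : MonoidAlgebra F G := ∑ n : N, MonoidAlgebra.single (n : G) 1 with he
  have hke : ∀ c, p c = 0 → c * e = 0 := by
    intro c h0
    ext g
    have h1 := aux_coeff_map N c g
    rw [← hp, h0] at h1
    rw [he, Finset.mul_sum]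
    simp only [MonoidAlgebra.coeff_sum, Finsupp.finsetSum_apply,
      MonoidAlgebra.coeff_mul_single_apply, mul_one]
    rw [← Equiv.sum_comp (Equiv.inv N)]
    simpa using h1.symm
  have hpe : p e = 1 := by
    have : ∀ n : N, p (MonoidAlgebra.single (n : G) 1) = 1 := by
      intro n
      have : ((n : G) : G ⧸ N) = 1 := (QuotientGroup.eq_one_iff _).mpr n.2
      simp [hp, MonoidAlgebra.mapDomain_single, MonoidAlgebra.one_def, this]
    rw [he, map_sum, Finset.sum_congr rfl (fun n _ => this n)]
    simp only [Finset.sum_const, Finset.card_univ, nsmul_eq_mul, mul_one]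
    rw [← map_natCast (algebraMap F (MonoidAlgebra F (G ⧸ N))), hcN, map_one]
  have hae := hke a ha
  have hea : e * a = 0 := by
    have := hc (1 - e) (by simp [hpe])
    simp only [mul_sub, sub_mul, mul_one, one_mul, hae] at this
    simpa using this.symm
  have := hc (b - b * e) (by simp [hpe])
  have h2 := hke (a * b) (by simp [ha])
  rw [mul_sub, ← mul_assoc, h2, sub_mul, mul_assoc b e a, hea] at this
  simpa using this

lemma aux_class (a : MonoidAlgebra F G) (hc : ∀ b, a * b = b * a) {g h : G} (hgh : IsConj g h) :
    a.coeff g = a.coeff h := by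
  obtain ⟨c, hc'⟩ := isConj_iff.mp hgh
  have h1 := congrArg (fun z => z.coeff (h * c)) (hc (MonoidAlgebra.single c 1))
  simp only [MonoidAlgebra.coeff_mul_single_apply, MonoidAlgebra.coeff_single_mul_apply] at h1
  rw [← hc'] at h1 ⊢
  simpa [mul_assoc] using h1.symm

open scoped Classical in
lemma aux_sum_coeff (s : Finset G) (g : G) :
    (∑ h ∈ s, MonoidAlgebra.of F G h).coeff g = if g ∈ s then 1 else 0 := by
  simp [MonoidAlgebra.of_apply, MonoidAlgebra.coeff_sum, Finsupp.finsetSum_apply,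
    Finsupp.single_apply]

lemma aux_sum_central (s : Finset G) (u : G) (hs : (s : Set G) = {h | IsConj u h})
    (b : MonoidAlgebra F G) :
    (∑ h ∈ s, MonoidAlgebra.of F G h) * b = b * ∑ h ∈ s, MonoidAlgebra.of F G h := by
  classical
  have hmem : ∀ h, h ∈ s ↔ IsConj u h := fun h => by
    rw [← Finset.mem_coe, hs]; rfl
  induction b using MonoidAlgebra.induction_linear with
  | zero => simp
  | add x y hx hy => rw [mul_add, add_mul, hx, hy]
  | single c r =>
    ext g
    rw [MonoidAlgebra.coeff_mul_single_apply, MonoidAlgebra.coeff_single_mul_apply,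
      aux_sum_coeff, aux_sum_coeff]
    have : g * c⁻¹ ∈ s ↔ c⁻¹ * g ∈ s := by
      rw [hmem, hmem]
      have hh : IsConj (g * c⁻¹) (c⁻¹ * g) := isConj_iff.mpr ⟨c⁻¹, by group⟩
      exact ⟨fun h => h.trans hh, fun h => h.trans hh.symm⟩
    simp [this]

lemma aux_sum_map (h3 : (3 : F) = 0) (s : Finset G) (hs : (s : Set G) ⊆ N) (hcard : s.card = 3) :
    MonoidAlgebra.mapDomainRingHom F (QuotientGroup.mk' N) (∑ h ∈ s, MonoidAlgebra.of F G h)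
      = 0 := by
  have : ∀ h ∈ s, MonoidAlgebra.mapDomainRingHom F (QuotientGroup.mk' N)
      (MonoidAlgebra.of F G h) = 1 := by
    intro h hh
    have : (h : G ⧸ N) = 1 := (QuotientGroup.eq_one_iff h).mpr (hs hh)
    simp [MonoidAlgebra.of_apply, MonoidAlgebra.mapDomain_single, MonoidAlgebra.one_def, this]
  rw [map_sum, Finset.sum_congr rfl this, Finset.sum_const, hcard]
  simp only [nsmul_eq_mul, mul_one]
  rw [← map_natCast (algebraMap F (MonoidAlgebra F (G ⧸ N)))]
  simp [h3]

open scoped Classical in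
lemma aux_main_s17 [Fintype N] (h3 : (3 : F) = 0) (hcN : (Fintype.card N : F) = 1)
    (hout : ∀ g, g ∉ N → ∀ n ∈ N, IsConj g (g * n)) {k : ℕ}
    (C : Fin k → Finset G)
    (hconj : ∀ i, ∃ g : G, (C i : Set G) = {h | IsConj g h})
    (hcard : ∀ i, (C i).card = 3)
    (hsub : ∀ i, (C i : Set G) ⊆ (N : Set G) \ {1})
    (hcover : (⋃ i, (C i : Set G)) = (N : Set G) \ {1})
    (hdisj : ∀ i j g, g ∈ C i → g ∈ C j → i = j) :
    {α ∈ RingHom.ker (MonoidAlgebra.mapDomainRingHom F (QuotientGroup.mk' N)) |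
      ∀ β ∈ RingHom.ker (MonoidAlgebra.mapDomainRingHom F (QuotientGroup.mk' N)), α * β = β * α}
      = (Submodule.span F (Set.range fun i : Fin k =>
          ∑ g ∈ C i, MonoidAlgebra.of F G g) : Submodule F (MonoidAlgebra F G)) ∧
    Module.finrank F (Submodule.span F (Set.range fun i : Fin k =>
        ∑ g ∈ C i, MonoidAlgebra.of F G g)) = k := by
  choose u hu using hconj
  have hmem : ∀ i h, h ∈ C i ↔ IsConj (u i) h := fun i h => by
    rw [← Finset.mem_coe, hu]; rfl
  have hui : ∀ i, u i ∈ C i := fun i => (hmem i _).mpr (IsConj.refl _)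
  have hcomb : ∀ (f : Fin k → F) (g : G),
      (∑ i, f i • ∑ h ∈ C i, MonoidAlgebra.of F G h).coeff g
        = ∑ i, if g ∈ C i then f i else 0 := by
    intro f g
    rw [MonoidAlgebra.coeff_sum, Finsupp.finsetSum_apply]
    refine Finset.sum_congr rfl fun i _ => ?_
    rw [MonoidAlgebra.coeff_smul, Finsupp.smul_apply, aux_sum_coeff]
    simp
  have hcomb1 : ∀ (f : Fin k → F) (g : G) (i : Fin k), g ∈ C i →
      (∑ i, f i • ∑ h ∈ C i, MonoidAlgebra.of F G h).coeff g = f i := by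
    intro f g i hg
    rw [hcomb, Finset.sum_eq_single i]
    · simp [hg]
    · intro j _ hj
      rw [if_neg]
      intro hgj
      exact hj (hdisj _ _ _ hgj hg)
    · simp
  have hmap : ∀ i, MonoidAlgebra.mapDomainRingHom F (QuotientGroup.mk' N)
      (∑ h ∈ C i, MonoidAlgebra.of F G h) = 0 := fun i =>
    aux_sum_map N h3 (C i) (fun g hg => (hsub i hg).1) (hcard i)
  have hspan : ∀ a ∈ Submodule.span F (Set.range fun i : Fin k =>
        ∑ g ∈ C i, MonoidAlgebra.of F G g),
      MonoidAlgebra.mapDomainRingHom F (QuotientGroup.mk' N) a = 0 ∧ ∀ b, a * b = b * a := by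
    intro a ha
    induction ha using Submodule.span_induction with
    | mem x hx =>
      obtain ⟨i, rfl⟩ := hx
      exact ⟨hmap i, fun b => aux_sum_central (C i) (u i) (hu i) b⟩
    | zero => simp
    | add x y _ _ hx hy =>
      exact ⟨by rw [map_add, hx.1, hy.1, add_zero], fun b => by
        rw [add_mul, mul_add, hx.2, hy.2]⟩
    | smul r x _ hx =>
      refine ⟨?_, fun b => by rw [smul_mul_assoc, mul_smul_comm, hx.2]⟩
      rw [Algebra.smul_def, map_mul, hx.1, mul_zero]
  constructor
  · apply Set.Subset.antisymm
    · rintro a ⟨ha, hc⟩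
      have ha : MonoidAlgebra.mapDomainRingHom F (QuotientGroup.mk' N) a = 0 := ha
      have hcen := aux_central N hcN a ha hc
      set γ : MonoidAlgebra F G :=
        ∑ i, a.coeff (u i) • ∑ h ∈ C i, MonoidAlgebra.of F G h with hγ
      have hγs : γ ∈ Submodule.span F (Set.range fun i : Fin k =>
          ∑ g ∈ C i, MonoidAlgebra.of F G g) := by
        refine Submodule.sum_mem _ fun i _ => Submodule.smul_mem _ _ ?_
        exact Submodule.subset_span ⟨i, rfl⟩
      have hne : ∀ g, g ≠ 1 → (a - γ).coeff g = 0 := by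
        intro g hg
        rw [MonoidAlgebra.coeff_sub, Finsupp.sub_apply]
        by_cases hgN : g ∈ N
        · have : g ∈ ⋃ i, (C i : Set G) := by rw [hcover]; exact ⟨hgN, hg⟩
          obtain ⟨i, hi⟩ := Set.mem_iUnion.mp this
          rw [hγ, hcomb1 _ g i hi, aux_class a hcen ((hmem i g).mp hi), sub_self]
        · have h1 : a.coeff g = 0 := by
            have h2 := aux_coeff_map N a g
            rw [ha, Finset.sum_congr rfl
              (fun (n : N) _ => (aux_class a hcen (hout g hgN n n.2)).symm)] at h2
            simpa [hcN] using h2.symm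
          have h2 : γ.coeff g = 0 := by
            rw [hγ, hcomb]
            refine Finset.sum_eq_zero fun i _ => if_neg fun hi => hgN (hsub i hi).1
          rw [h1, h2, sub_self]
      have hs : a - γ = MonoidAlgebra.single 1 ((a - γ).coeff 1) := by
        ext g
        by_cases hg : g = 1
        · subst hg; simp
        · rw [hne g hg, MonoidAlgebra.coeff_single, Finsupp.single_apply, if_neg (Ne.symm hg)]
      have hp : MonoidAlgebra.mapDomainRingHom F (QuotientGroup.mk' N) (a - γ) = 0 := by
        rw [map_sub, ha, (hspan γ hγs).1, sub_zero]
      have h0 : (a - γ).coeff 1 = 0 := by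
        rw [hs, MonoidAlgebra.mapDomainRingHom_apply, MonoidAlgebra.mapDomain_single] at hp
        exact MonoidAlgebra.single_eq_zero.mp hp
      rw [h0, MonoidAlgebra.single_zero, sub_eq_zero] at hs
      rw [hs]
      exact hγs
    · intro a ha
      exact ⟨(hspan a ha).1, fun b _ => (hspan a ha).2 b⟩
  · rw [finrank_span_eq_card, Fintype.card_fin]
    rw [Fintype.linearIndependent_iff]
    intro f hf i
    have := hcomb1 f (u i) i (hui i)
    rw [hf] at this
    simpa using this.symm

end General

section T3

variable (m t : ℕ)

lemma aux_x_pow : xg m t ^ m = 1 :=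
  (PresentedGroup.one_of_mem (rels := T3mRels m t) (x := FreeGroup.of 0 ^ m)
    (by simp [T3mRels]))

lemma aux_y_pow : yg m t ^ 3 = 1 :=
  (PresentedGroup.one_of_mem (rels := T3mRels m t) (x := FreeGroup.of 1 ^ 3)
    (by simp [T3mRels]))

lemma aux_rel : (yg m t)⁻¹ * xg m t * yg m t = xg m t ^ t := by
  have := (PresentedGroup.one_of_mem (rels := T3mRels m t)
    (x := (FreeGroup.of 1)⁻¹ * FreeGroup.of 0 * FreeGroup.of 1 * (FreeGroup.of 0 ^ t)⁻¹)
    (by simp [T3mRels]))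
  exact mul_inv_eq_one.mp this

lemma aux_order (hm : 0 < m) (ht : t ^ 3 % m = 1 % m) : orderOf (xg m t) = m := by
  have ht' : (t : ZMod m) ^ 3 = 1 := by
    have := (ZMod.natCast_eq_natCast_iff (t ^ 3) 1 m).mpr ht
    simpa using this
  let X : Equiv.Perm (ZMod m) := Equiv.addRight 1
  let Y : Equiv.Perm (ZMod m) :=
    { toFun := fun a => a * t ^ 2
      invFun := fun a => a * t
      left_inv := fun a => by linear_combination a * ht'
      right_inv := fun a => by linear_combination a * ht' }
  have hX : ∀ (n : ℕ) (a : ZMod m), (X ^ n) a = a + n := by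
    intro n
    induction n with
    | zero => simp
    | succ n ih => intro a; rw [pow_succ, Equiv.Perm.mul_apply, ih]; simp [X]; ring
  have hY : ∀ a, Y a = a * t ^ 2 := fun _ => rfl
  have hYi : ∀ a, Y⁻¹ a = a * t := fun _ => rfl
  have hrel : ∀ r ∈ T3mRels m t, FreeGroup.lift ![X, Y] r = 1 := by
    intro r hr
    simp only [T3mRels, Set.mem_insert_iff, Set.mem_singleton_iff] at hr
    rcases hr with rfl | rfl | rfl
    · ext1 a
      simp [hX]
    · ext1 a
      simp only [map_pow, FreeGroup.lift_apply_of, Matrix.cons_val_one, Matrix.cons_val_zero]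
      simp only [pow_succ, pow_zero, one_mul, Equiv.Perm.mul_apply, hY, Equiv.Perm.one_apply]
      linear_combination a * (t ^ 3 + 1) * ht'
    · simp only [map_mul, map_inv, map_pow, FreeGroup.lift_apply_of, Matrix.cons_val_one,
        Matrix.cons_val_zero]
      rw [mul_inv_eq_one]
      ext1 a
      have hX1 : ∀ a, X a = a + 1 := fun _ => rfl
      simp only [Equiv.Perm.mul_apply, hX, hY, hYi, hX1]
      linear_combination a * ht'
  let f := PresentedGroup.toGroup hrel
  have hf : f (xg m t) = X := PresentedGroup.toGroup.of hrel
  apply Nat.dvd_antisymm (orderOf_dvd_of_pow_eq_one (aux_x_pow m t))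
  have h1 : X ^ orderOf (xg m t) = 1 := by rw [← hf, ← map_pow, pow_orderOf_eq_one, map_one]
  have h2 := hX (orderOf (xg m t)) 0
  rw [h1] at h2
  rw [← ZMod.natCast_eq_zero_iff]
  simpa using h2.symm

lemma aux_cosets [(Subgroup.zpowers (xg m t)).Normal] (g : T3m m t) :
    ∃ n ∈ Subgroup.zpowers (xg m t), g = n ∨ g = yg m t * n ∨ g = (yg m t)⁻¹ * n := by
  set N := Subgroup.zpowers (xg m t) with hN
  have htop : (Subgroup.zpowers (QuotientGroup.mk' N (yg m t))).comap (QuotientGroup.mk' N)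
      = ⊤ := by
    rw [eq_top_iff, ← PresentedGroup.closure_range_of, Subgroup.closure_le]
    rintro _ ⟨i, rfl⟩
    fin_cases i
    · have : QuotientGroup.mk' N (xg m t) = 1 :=
        (QuotientGroup.eq_one_iff _).mpr (Subgroup.mem_zpowers _)
      change QuotientGroup.mk' N (xg m t) ∈ Subgroup.zpowers (QuotientGroup.mk' N (yg m t))
      rw [this]
      exact one_mem _
    · exact Subgroup.mem_zpowers _
  have hg : g ∈ (Subgroup.zpowers (QuotientGroup.mk' N (yg m t))).comap (QuotientGroup.mk' N) := by
    rw [htop]; trivial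
  obtain ⟨j, hj⟩ := Subgroup.mem_zpowers_iff.mp (Subgroup.mem_comap.mp hg)
  rw [← map_zpow] at hj
  have hn : (yg m t ^ j)⁻¹ * g ∈ N := QuotientGroup.eq.mp hj
  refine ⟨_, hn, ?_⟩
  have hy3 : yg m t ^ (3 : ℤ) = 1 := by exact_mod_cast aux_y_pow m t
  have h : yg m t ^ j = 1 ∨ yg m t ^ j = yg m t ∨ yg m t ^ j = (yg m t)⁻¹ := by
    have hq : ∀ q : ℤ, yg m t ^ (3 * q) = 1 := fun q => by rw [zpow_mul, hy3, one_zpow]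
    have : j = 3 * (j / 3) + 0 ∨ j = 3 * (j / 3) + 1 ∨ j = 3 * (j / 3 + 1) + (-1) := by omega
    rcases this with h | h | h
    · left; rw [h, zpow_add, hq]; simp
    · right; left; rw [h, zpow_add, hq]; simp
    · right; right; rw [h, zpow_add, hq]; simp
  rcases h with h | h | h <;> rw [h]
  · left; group
  · right; left; group
  · right; right; group

lemma aux_y_conj (ht1 : 1 ≤ t) (hgcd : Nat.gcd m (t - 1) = 1) (n : T3m m t)
    (hn : n ∈ Subgroup.zpowers (xg m t)) : IsConj (yg m t) (yg m t * n) := by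
  obtain ⟨i, rfl⟩ := Subgroup.mem_zpowers_iff.mp hn
  have hb := Nat.gcd_eq_gcd_ab m (t - 1)
  rw [hgcd] at hb
  push_cast [ht1] at hb
  set a := Nat.gcdA m (t - 1)
  set b := Nat.gcdB m (t - 1)
  have hxm : xg m t ^ (m : ℤ) = 1 := by exact_mod_cast aux_x_pow m t
  have hr : ∀ j : ℤ, (yg m t)⁻¹ * xg m t ^ j * yg m t = xg m t ^ (t * j) := by
    intro j
    have := conj_zpow (i := j) (a := (yg m t)⁻¹) (b := xg m t)
    rw [inv_inv, aux_rel] at this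
    rw [← this, zpow_mul, zpow_natCast]
  rw [isConj_iff]
  refine ⟨xg m t ^ (b * i), ?_⟩
  have h1 : xg m t ^ (b * i) * yg m t = yg m t * xg m t ^ (t * (b * i)) := by
    rw [← hr]; group
  rw [h1, mul_assoc, ← zpow_neg, ← zpow_add]
  congr 1
  have h2 : (t : ℤ) * (b * i) + -(b * i) = i + m * (- a * i) := by
    linear_combination -i * hb
  rw [h2, zpow_add, zpow_mul, hxm, one_zpow, mul_one]

lemma aux_out [hN : (Subgroup.zpowers (xg m t)).Normal] (ht1 : 1 ≤ t)
    (hgcd : Nat.gcd m (t - 1) = 1) (g : T3m m t)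
    (hg : g ∉ Subgroup.zpowers (xg m t)) (n : T3m m t)
    (hn : n ∈ Subgroup.zpowers (xg m t)) : IsConj g (g * n) := by
  have hyc := aux_y_conj m t ht1 hgcd
  have hinv : ∀ a b : T3m m t, IsConj a b → IsConj a⁻¹ b⁻¹ := by
    intro a b h
    obtain ⟨c, rfl⟩ := isConj_iff.mp h
    exact isConj_iff.mpr ⟨c, by group⟩
  obtain ⟨n0, hn0, rfl | rfl | rfl⟩ := aux_cosets m t g
  · exact absurd hn0 hg
  · rw [mul_assoc]
    exact (hyc n0 hn0).symm.trans (hyc _ (mul_mem hn0 hn))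
  · have key : ∀ n ∈ Subgroup.zpowers (xg m t), IsConj (yg m t)⁻¹ ((yg m t)⁻¹ * n) := by
      intro n hn
      have h1 : (yg m t)⁻¹ * n⁻¹ * yg m t ∈ Subgroup.zpowers (xg m t) := by
        simpa using hN.conj_mem _ (inv_mem hn) (yg m t)⁻¹
      have h2 := hinv _ _ (hyc _ h1)
      convert h2 using 1
      group
    rw [mul_assoc]
    exact (key n0 hn0).symm.trans (key _ (mul_mem hn0 hn))

end T3

open scoped Classical

/-- For a finite field `F` of characteristic 3 and `G = T_{3m}` with conjugacy classes `{1}`,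
`C_1, …, C_k` (each of size 3, inside `⟨x⟩`), `⟨x⟩y` and `⟨x⟩y⁻¹`: the center of
`Δ(G,⟨x⟩)` is the `F`-span of the class sums `Ĉ_1, …, Ĉ_k`, which has dimension `k`. -/
theorem center_aug_eq_span_class_sums (F : Type*) [Field F] [Fintype F] [CharP F 3]
    (m t k : ℕ) (ht1 : 1 ≤ t) (hm : m = 3 * k + 1) (ht : t ^ 3 % m = 1 % m)
    (hgcd : Nat.gcd m (t - 1) = 1) [hN : (Subgroup.zpowers (xg m t)).Normal]
    (C : Fin k → Finset (T3m m t))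
    (hconj : ∀ i, ∃ g : T3m m t, (C i : Set (T3m m t)) = {h | IsConj g h})
    (hcard : ∀ i, (C i).card = 3)
    (hsub : ∀ i, (C i : Set (T3m m t))
      ⊆ (Subgroup.zpowers (xg m t) : Set (T3m m t)) \ {1})
    (hcover : (⋃ i, (C i : Set (T3m m t)))
      = (Subgroup.zpowers (xg m t) : Set (T3m m t)) \ {1}) :
    {α ∈ RingHom.ker (MonoidAlgebra.mapDomainRingHom F
        (QuotientGroup.mk' (Subgroup.zpowers (xg m t)))) |
      ∀ β ∈ RingHom.ker (MonoidAlgebra.mapDomainRingHom F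
          (QuotientGroup.mk' (Subgroup.zpowers (xg m t)))), α * β = β * α}
      = (Submodule.span F (Set.range fun i : Fin k =>
          ∑ g ∈ C i, MonoidAlgebra.of F (T3m m t) g) : Submodule F (MonoidAlgebra F (T3m m t))) ∧
    Module.finrank F (Submodule.span F (Set.range fun i : Fin k =>
        ∑ g ∈ C i, MonoidAlgebra.of F (T3m m t) g)) = k := by
  have hmpos : 0 < m := by omega
  have hord := aux_order m t hmpos ht
  have hfin : Finite (Subgroup.zpowers (xg m t)) := by
    exact Set.Finite.to_subtype (finite_zpowers.mpr (orderOf_pos_iff.mp (by omega)))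
  letI : Fintype (Subgroup.zpowers (xg m t)) := Fintype.ofFinite _
  have hcardN : Fintype.card (Subgroup.zpowers (xg m t)) = m := by
    rw [Fintype.card_eq_nat_card, Nat.card_zpowers, hord]
  have h3 : (3 : F) = 0 := by exact_mod_cast CharP.cast_eq_zero F 3
  have hcN : (Fintype.card (Subgroup.zpowers (xg m t)) : F) = 1 := by
    rw [hcardN, hm]; push_cast; rw [h3]; ring
  -- the covering map from the disjoint union of the classes is a bijection, by counting
  let S := {g : T3m m t // g ∈ (Subgroup.zpowers (xg m t) : Set (T3m m t)) \ {1}}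
  have hSc : Nat.card S = 3 * k := by
    change Set.ncard ((Subgroup.zpowers (xg m t) : Set (T3m m t)) \ {1}) = 3 * k
    have hnc : Set.ncard (Subgroup.zpowers (xg m t) : Set (T3m m t)) = m := by
      change Nat.card (Subgroup.zpowers (xg m t)) = m
      rw [Nat.card_zpowers, hord]
    rw [Set.ncard_sdiff_singleton_of_mem (one_mem _), hnc, hm]
    rfl
  let φ : (Σ i : Fin k, C i) → S := fun p => ⟨p.2.1, hsub p.1 p.2.2⟩
  have hφ : Function.Surjective φ := by
    rintro ⟨g, hg⟩
    rw [← hcover] at hg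
    obtain ⟨i, hi⟩ := Set.mem_iUnion.mp hg
    exact ⟨⟨i, g, hi⟩, rfl⟩
  have hdc : Nat.card (Σ i : Fin k, C i) = 3 * k := by
    rw [Nat.card_eq_fintype_card, Fintype.card_sigma]
    simp [hcard, mul_comm]
  have hinj : Function.Injective φ :=
    ((Nat.bijective_iff_surjective_and_card φ).mpr ⟨hφ, by rw [hdc, hSc]⟩).1
  have hdisj : ∀ i j g, g ∈ C i → g ∈ C j → i = j := by
    intro i j g hi hj
    have : (⟨i, g, hi⟩ : Σ i : Fin k, C i) = ⟨j, g, hj⟩ := hinj rfl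
    exact congrArg Sigma.fst this
  exact aux_main_s17 (Subgroup.zpowers (xg m t)) h3 hcN (aux_out m t ht1 hgcd) C hconj hcard hsub
    hcover hdisj
end

section
/- Let F = F_{3^n} and G = T_{39} = ⟨x, y | x^{13} = y^3 = 1, y^{-1}xy = x^3⟩. Then the unit group of the group algebra FG is isomorphic to C_3^{2n} × C_{3^n − 1} × GL_3(F)^4. -/
open Matrix

namespace T39

abbrev C3 := Multiplicative (ZMod 3)

def XM : Matrix (Fin 3) (Fin 3) (ZMod 3) := !![0, 0, 1; 0, 2, 2; 1, 2, 0]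
def YM : Matrix (Fin 3) (Fin 3) (ZMod 3) := !![0, 1, 0; 0, 0, 1; 1, 0, 0]
/-- Representatives of the cosets of `⟨3⟩` in `(ℤ/13)ˣ`. -/
def ex : Fin 4 → ℕ := ![1, 2, 4, 7]
/-- Inverses of `ex` modulo 13. -/
def exInv : Fin 4 → ℕ := ![1, 7, 10, 2]
/-- Coefficients of the primitive idempotents of `𝔽₃C₁₃`. -/
def idc (i : Fin 4) (k : ℕ) : ZMod 3 := (XM ^ (12 * ex i * k % 13)).trace
/-- Coefficients expressing matrix units through `XM ^ a * YM ^ b`. -/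
def tab : Fin 3 → Fin 3 → Fin 3 → Fin 3 → ZMod 3 :=
  ![![![![1, 2, 0], ![0, 2, 2], ![2, 1, 1]], ![![0, 1, 2], ![2, 0, 2], ![1, 2, 1]],
      ![![2, 0, 1], ![2, 2, 0], ![1, 1, 2]]],
    ![![![0, 1, 2], ![2, 2, 2], ![1, 1, 0]], ![![2, 0, 1], ![2, 2, 2], ![0, 1, 1]],
      ![![1, 2, 0], ![2, 2, 2], ![1, 0, 1]]],
    ![![![2, 1, 1], ![2, 1, 2], ![1, 1, 1]], ![![1, 2, 1], ![2, 2, 1], ![1, 1, 1]],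
      ![![1, 1, 2], ![1, 2, 2], ![1, 1, 1]]]]

lemma XM_pow : XM ^ 13 = 1 := by decide +kernel
lemma YM_pow : YM ^ 3 = 1 := by decide +kernel
lemma XM_YM : XM * YM = YM * XM ^ 3 := by decide +kernel
lemma ex_inv (i : Fin 4) : (XM ^ ex i) ^ exInv i = XM := by
  revert i; decide +kernel
lemma idc_sum (i : Fin 4) : ∑ k ∈ Finset.range 13, idc i k = 0 := by
  revert i; decide +kernel
lemma idc_mat (i l : Fin 4) :
    ∑ k ∈ Finset.range 13, idc i k • (XM ^ ex l) ^ k = if l = i then 1 else 0 := by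
  revert i l; decide +kernel
lemma all_mat (l : Fin 4) :
    ∑ k ∈ Finset.range 13, (XM ^ ex l) ^ k = 0 := by
  revert l; decide +kernel
lemma tab_mat (j k : Fin 3) :
    ∑ a, ∑ b, tab j k a b • (XM ^ (a : ℕ) * YM ^ (b : ℕ)) = Matrix.single j k 1 := by
  revert j k; decide +kernel

/-! ### The group -/

lemma rel_x : xg 13 3 ^ 13 = 1 := by
  have : (PresentedGroup.mk (T3mRels 13 3)) (FreeGroup.of 0 ^ 13) = 1 :=
    PresentedGroup.one_of_mem (by simp [T3mRels])
  rw [map_pow] at this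
  exact this

lemma rel_y : yg 13 3 ^ 3 = 1 := by
  have : (PresentedGroup.mk (T3mRels 13 3)) (FreeGroup.of 1 ^ 3) = 1 :=
    PresentedGroup.one_of_mem (by simp [T3mRels])
  rw [map_pow] at this
  exact this

lemma rel_xy : xg 13 3 * yg 13 3 = yg 13 3 * xg 13 3 ^ 3 := by
  have : (PresentedGroup.mk (T3mRels 13 3))
    ((FreeGroup.of 1)⁻¹ * FreeGroup.of 0 * FreeGroup.of 1 * (FreeGroup.of 0 ^ 3)⁻¹) = 1 :=
    PresentedGroup.one_of_mem (by simp [T3mRels])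
  have h : (yg 13 3)⁻¹ * xg 13 3 * yg 13 3 * (xg 13 3 ^ 3)⁻¹ = 1 := by
    rw [map_mul, map_mul, map_mul, map_inv, map_inv, map_pow] at this
    exact this
  rw [mul_inv_eq_one, mul_assoc, inv_mul_eq_iff_eq_mul] at h
  exact h

lemma rel_xy' (j : ℕ) : xg 13 3 * yg 13 3 ^ j = yg 13 3 ^ j * xg 13 3 ^ (3 ^ j) := by
  have hc (i : ℕ) : xg 13 3 ^ i * yg 13 3 = yg 13 3 * xg 13 3 ^ (3 * i) := by
    have : SemiconjBy (yg 13 3) (xg 13 3 ^ 3) (xg 13 3) := rel_xy.symm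
    have := this.pow_right i
    rw [← pow_mul] at this
    exact this.eq.symm
  induction j with
  | zero => simp
  | succ j ih =>
    rw [pow_succ, ← mul_assoc, ih, mul_assoc, hc, ← mul_assoc, pow_succ' 3]

lemma normal_form (g : T3m 13 3) : ∃ j i : ℕ, g = yg 13 3 ^ j * xg 13 3 ^ i := by
  have hx (g) : (∃ j i : ℕ, g = yg 13 3 ^ j * xg 13 3 ^ i) →
      ∃ j i : ℕ, xg 13 3 * g = yg 13 3 ^ j * xg 13 3 ^ i := by
    rintro ⟨j, i, rfl⟩
    exact ⟨j, 3 ^ j + i, by rw [← mul_assoc, rel_xy', pow_add, mul_assoc]⟩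
  have hy (g) : (∃ j i : ℕ, g = yg 13 3 ^ j * xg 13 3 ^ i) →
      ∃ j i : ℕ, yg 13 3 * g = yg 13 3 ^ j * xg 13 3 ^ i := by
    rintro ⟨j, i, rfl⟩
    exact ⟨j + 1, i, by rw [← mul_assoc, pow_succ']⟩
  have hxi : (xg 13 3)⁻¹ = xg 13 3 ^ 12 := inv_eq_of_mul_eq_one_right (by rw [← pow_succ', rel_x])
  have hyi : (yg 13 3)⁻¹ = yg 13 3 ^ 2 := inv_eq_of_mul_eq_one_right (by rw [← pow_succ', rel_y])
  have hpow (z : T3m 13 3) (hz : ∀ g, (∃ j i : ℕ, g = yg 13 3 ^ j * xg 13 3 ^ i) →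
      ∃ j i : ℕ, z * g = yg 13 3 ^ j * xg 13 3 ^ i) (n : ℕ) (g) 
      (hg : ∃ j i : ℕ, g = yg 13 3 ^ j * xg 13 3 ^ i) :
      ∃ j i : ℕ, z ^ n * g = yg 13 3 ^ j * xg 13 3 ^ i := by
    induction n with
    | zero => simpa using hg
    | succ n ih => rw [pow_succ', mul_assoc]; exact hz _ ih
  have hg : g ∈ Subgroup.closure (Set.range (PresentedGroup.of (rels := T3mRels 13 3))) := by
    rw [PresentedGroup.closure_range_of]; trivial
  induction hg using Subgroup.closure_induction_left with
  | one => exact ⟨0, 0, by simp⟩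
  | mul_left z hz g _ ih =>
    obtain ⟨s, rfl⟩ := hz
    fin_cases s
    · exact hx _ ih
    · exact hy _ ih
  | inv_mul_cancel z hz g _ ih =>
    obtain ⟨s, rfl⟩ := hz
    fin_cases s
    · change ∃ j i : ℕ, (xg 13 3)⁻¹ * g = _
      rw [hxi]; exact hpow _ hx _ _ ih
    · change ∃ j i : ℕ, (yg 13 3)⁻¹ * g = _
      rw [hyi]; exact hpow _ hy _ _ ih

lemma nf_surj : Function.Surjective
    (fun p : Fin 3 × Fin 13 => yg 13 3 ^ (p.1 : ℕ) * xg 13 3 ^ (p.2 : ℕ)) := by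
  intro g
  obtain ⟨j, i, rfl⟩ := normal_form g
  refine ⟨(⟨j % 3, Nat.mod_lt _ (by norm_num)⟩, ⟨i % 13, Nat.mod_lt _ (by norm_num)⟩), ?_⟩
  simp only
  rw [← pow_eq_pow_mod i rel_x, ← pow_eq_pow_mod j rel_y]

lemma card_le : Finite (T3m 13 3) ∧ Nat.card (T3m 13 3) ≤ 39 := by
  refine ⟨Finite.of_surjective _ nf_surj, ?_⟩
  simpa using Nat.card_le_card_of_surjective _ nf_surj

/-! ### The commutative part -/
lemma C3_pow : ∀ g : C3, g ^ 3 = 1 := by decide +kernel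

section comm
variable (F : Type*) [Field F] [CharP F 3]

abbrev S := MonoidAlgebra F C3

noncomputable def aug : S F →ₐ[F] F := MonoidAlgebra.lift F F C3 1

lemma cube (u : S F) : u ^ 3 = algebraMap F (S F) (aug F u ^ 3) := by
  have : CharP (S F) 3 := charP_of_injective_algebraMap (algebraMap F (S F)).injective 3
  have : Fact (Nat.Prime 3) := ⟨by norm_num⟩
  have hg : ∀ g : C3, g ^ 3 = 1 := by exact C3_pow
  induction u using MonoidAlgebra.induction_on with
  | of g => 
    rw [← map_pow, hg]; simp [aug]
  | add a b ha hb =>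
    rw [add_pow_char, ha, hb, map_add, add_pow_char, map_add]
  | smul r f h =>
    rw [smul_pow, h, map_smul, smul_eq_mul, mul_pow, map_mul, Algebra.smul_def]

lemma aug_surj : Function.Surjective (aug F) := fun a => ⟨algebraMap F _ a, (aug F).commutes a⟩

lemma isUnit_of_aug (u : S F) (h : aug F u ≠ 0) : IsUnit u := by
  have : IsUnit (u ^ 3) := by
    rw [cube]; exact (IsUnit.mk0 _ (pow_ne_zero _ h)).map _
  exact (isUnit_pow_iff (by norm_num)).1 this

noncomputable def augU : (S F)ˣ →* Fˣ := Units.map (aug F : S F →* F)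
noncomputable def incU : Fˣ →* (S F)ˣ := Units.map (algebraMap F (S F) : F →* S F)

lemma augU_incU (a : Fˣ) : augU F (incU F a) = a := by
  ext; exact (aug F).commutes _

noncomputable def splitU : (augU F).ker × Fˣ ≃* (S F)ˣ :=
  MulEquiv.ofBijective ((augU F).ker.subtype.coprod (incU F)) <| by
    constructor
    · rw [injective_iff_map_eq_one]
      rintro ⟨⟨k, hk⟩, a⟩ h
      have h' : k * incU F a = 1 := by simpa using h
      have ha : a = 1 := by
        have := congrArg (augU F) h'
        rw [map_mul, augU_incU, MonoidHom.mem_ker.1 hk] at this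
        simpa using this
      subst ha
      have : k = 1 := by simpa using h'
      subst this
      rfl
    · intro u
      refine ⟨(⟨u * (incU F (augU F u))⁻¹, ?_⟩, augU F u), ?_⟩
      · rw [MonoidHom.mem_ker, map_mul, map_inv, augU_incU, mul_inv_cancel]
      · simp

noncomputable def kerEquiv : (augU F).ker ≃ LinearMap.ker (aug F).toLinearMap where
  toFun k := ⟨((k : (S F)ˣ) : S F) - 1, by
    have : aug F ((k : (S F)ˣ) : S F) = 1 := congrArg Units.val (MonoidHom.mem_ker.1 k.2)
    simp [this]⟩
  invFun v := ⟨(isUnit_of_aug F (v + 1) (by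
    have : aug F v = 0 := v.2
    simp [this])).unit, by
      have : aug F v = 0 := v.2
      rw [MonoidHom.mem_ker]
      ext
      simp [augU, this]⟩
  left_inv k := by ext; simp
  right_inv v := by ext; simp

lemma card_ker [Fintype F] (n : ℕ) (hF : Fintype.card F = 3 ^ n) :
    Nat.card (augU F).ker = 3 ^ (2 * n) := by
  rw [Nat.card_congr (kerEquiv F)]
  have h := LinearMap.finrank_range_add_finrank_ker (aug F).toLinearMap
  rw [LinearMap.range_eq_top.2 (aug_surj F), finrank_top] at h
  have h3 : Module.finrank F (S F) = 3 := by
    rw [Module.finrank_eq_card_basis (MonoidAlgebra.basis C3 F)]; rfl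
  have h1 : Module.finrank F F = 1 := Module.finrank_self F
  have h2 : Module.finrank F (LinearMap.ker (aug F).toLinearMap) = 2 := by omega
  rw [Module.natCard_eq_pow_finrank (K := F), h2, Nat.card_eq_fintype_card, hF, ← pow_mul, mul_comm]

lemma ker_equiv [Fintype F] (n : ℕ) (hF : Fintype.card F = 3 ^ n) :
    Nonempty ((augU F).ker ≃* (Fin (2 * n) → Multiplicative (ZMod 3))) := by
  have : Fact (Nat.Prime 3) := ⟨by norm_num⟩
  have hexp (k : Additive (augU F).ker) : 3 • k = 0 := by
    change Additive.ofMul (k.toMul ^ 3) = 0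
    rw [ofMul_eq_zero]
    refine Subtype.ext ?_
    have : aug F ((k.toMul : (S F)ˣ) : S F) = 1 :=
      congrArg Units.val (MonoidHom.mem_ker.1 k.toMul.2)
    refine Units.ext ?_
    simp only [SubmonoidClass.coe_pow, Units.val_pow_eq_pow_val, cube, this, one_pow, map_one]
    rfl
  let : Module (ZMod 3) (Additive (augU F).ker) := AddCommGroup.zmodModule hexp
  have hc : Nat.card (Additive (augU F).ker) = 3 ^ (2 * n) := card_ker F n hF
  have : Finite (Additive (augU F).ker) := Nat.finite_of_card_ne_zero (by rw [hc]; positivity)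
  have hr : Module.finrank (ZMod 3) (Additive (augU F).ker) = 2 * n := by
    have := Module.natCard_eq_pow_finrank (K := ZMod 3) (V := Additive (augU F).ker)
    rw [hc, Nat.card_zmod] at this
    exact (Nat.pow_right_injective (le_refl _ |>.trans (by norm_num : 2 ≤ 3)) this).symm
  have e : Additive (augU F).ker ≃ₗ[ZMod 3] (Fin (2 * n) → ZMod 3) :=
    LinearEquiv.ofFinrankEq _ _ (by simp [hr])
  exact ⟨{ toFun := fun k i => Multiplicative.ofAdd (e (Additive.ofMul k) i)
           invFun := fun v => (e.symm (fun i => (v i).toAdd)).toMul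
           left_inv := fun k => by simp
           right_inv := fun v => by simp
           map_mul' := fun a b => by ext i; simp }⟩

end comm

/-! ### The algebra map -/
section main
variable (F : Type*) [Field F] [CharP F 3]

abbrev T := S F × (Fin 4 → Matrix (Fin 3) (Fin 3) F)

noncomputable def mu : Matrix (Fin 3) (Fin 3) (ZMod 3) →+* Matrix (Fin 3) (Fin 3) F :=
  (ZMod.castHom (dvd_refl 3) F).mapMatrix

lemma mu_smul (c : ZMod 3) (M) : mu F (c • M) = (ZMod.castHom (dvd_refl 3) F c) • mu F M := by
  ext i j; simp [mu]

noncomputable def gy : C3 := Multiplicative.ofAdd 1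

noncomputable def tx : T F := (1, fun i => mu F (XM ^ ex i))
noncomputable def ty : T F := (MonoidAlgebra.of F C3 gy, fun _ => mu F YM)

lemma tx_pow : tx F ^ 13 = 1 := by
  ext1
  · simp [tx]
  · funext i
    simp only [tx, Prod.pow_snd, Pi.pow_apply, ← map_pow, Prod.snd_one, Pi.one_apply]
    rw [← pow_mul, mul_comm, pow_mul, XM_pow, one_pow, map_one]

lemma ty_pow : ty F ^ 3 = 1 := by
  ext1
  · simp only [ty, Prod.pow_fst, Prod.fst_one]
    rw [← map_pow, show gy ^ 3 = 1 by decide +kernel, map_one]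
  · funext i
    simp only [ty, Prod.pow_snd, Pi.pow_apply, ← map_pow, Prod.snd_one, Pi.one_apply]
    rw [YM_pow, map_one]

lemma tx_ty : tx F * ty F = ty F * tx F ^ 3 := by
  ext1
  · simp [tx, ty]
  · funext i
    simp only [tx, ty, Prod.snd_mul, Prod.pow_snd, Pi.pow_apply, Pi.mul_apply, ← map_pow, ← map_mul]
    have : SemiconjBy YM (XM ^ 3) XM := XM_YM.symm
    have := this.pow_right (ex i)
    rw [← pow_mul, mul_comm 3, pow_mul] at this
    rw [this.eq]

noncomputable def ux : (T F)ˣ := Units.ofPowEqOne (tx F) 13 (tx_pow F) (by norm_num)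
noncomputable def uy : (T F)ˣ := Units.ofPowEqOne (ty F) 3 (ty_pow F) (by norm_num)

noncomputable def rho : T3m 13 3 →* (T F)ˣ :=
  PresentedGroup.toGroup (f := ![ux F, uy F]) <| by
    intro r hr
    simp only [T3mRels, Set.mem_insert_iff, Set.mem_singleton_iff] at hr
    rcases hr with rfl | rfl | rfl
    · ext1; simpa [ux] using tx_pow F
    · ext1; simpa [uy] using ty_pow F
    · have : ux F * uy F = uy F * ux F ^ 3 := by ext1; simpa [ux, uy] using tx_ty F
      have h2 : (uy F)⁻¹ * ux F * uy F * (ux F ^ 3)⁻¹ = 1 := by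
        rw [mul_inv_eq_one, mul_assoc, this, inv_mul_cancel_left]
      simpa using h2

noncomputable def Phi : MonoidAlgebra F (T3m 13 3) →ₐ[F] T F :=
  MonoidAlgebra.lift F (T F) (T3m 13 3) ((Units.coeHom (T F)).comp (rho F))

lemma tx_mem : tx F ∈ (Phi F).range :=
  ⟨MonoidAlgebra.of F _ (xg 13 3), by simp [Phi, rho, xg, ux]⟩

lemma ty_mem : ty F ∈ (Phi F).range :=
  ⟨MonoidAlgebra.of F _ (yg 13 3), by simp [Phi, rho, yg, uy]⟩

lemma e0_mem : ((1, 0) : T F) ∈ (Phi F).range := by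
  have h : ∑ k ∈ Finset.range 13, tx F ^ k ∈ (Phi F).range :=
    sum_mem fun k _ => pow_mem (tx_mem F) k
  convert h using 1
  ext1
  · have : (13 : S F) = 1 := by
      have : CharP (S F) 3 := charP_of_injective_algebraMap (algebraMap F (S F)).injective 3
      have h3 : (3 : S F) = 0 := by exact_mod_cast CharP.cast_eq_zero (S F) 3
      linear_combination 4 * h3
    simp [Prod.fst_sum, tx, this]
  · funext l
    simp only [Prod.snd_sum, Finset.sum_apply, tx, Prod.pow_snd, Pi.pow_apply, ← map_pow, ← map_sum,
      all_mat, map_zero, Pi.zero_apply]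

lemma ei_mem (i : Fin 4) : ((0, Pi.single i 1) : T F) ∈ (Phi F).range := by
  have h : ∑ k ∈ Finset.range 13, (ZMod.castHom (dvd_refl 3) F (idc i k)) • tx F ^ k
      ∈ (Phi F).range :=
    sum_mem fun k _ => Subalgebra.smul_mem _ (pow_mem (tx_mem F) k) _
  convert h using 1
  ext1
  · simp only [Prod.fst_sum, Prod.smul_fst, Prod.pow_fst, tx, one_pow]
    rw [← Finset.sum_smul, ← map_sum, idc_sum, map_zero, zero_smul]
  · funext l
    simp only [Prod.snd_sum, Finset.sum_apply, Prod.smul_snd, Pi.smul_apply, tx, Prod.pow_snd,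
      Pi.pow_apply, ← map_pow, ← mu_smul, ← map_sum, idc_mat]
    rw [Pi.single_apply]; split_ifs <;> simp

lemma single_mem (i : Fin 4) (j k : Fin 3) :
    ((0, Pi.single i (Matrix.single j k 1)) : T F) ∈ (Phi F).range := by
  have h : (0, Pi.single i 1) * ∑ a : Fin 3, ∑ b : Fin 3,
      (ZMod.castHom (dvd_refl 3) F (tab j k a b)) • ((tx F ^ exInv i) ^ (a : ℕ) * ty F ^ (b : ℕ))
      ∈ (Phi F).range :=
    mul_mem (ei_mem F i) <| sum_mem fun a _ => sum_mem fun b _ => Subalgebra.smul_mem _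
      (mul_mem (pow_mem (pow_mem (tx_mem F) _) _) (pow_mem (ty_mem F) _)) _
  convert h using 1
  ext1
  · simp
  · funext l
    simp only [Prod.snd_mul, Pi.mul_apply]
    by_cases hl : l = i
    · subst hl
      simp only [Pi.single_eq_same, one_mul, Prod.snd_sum, Finset.sum_apply, Prod.smul_snd,
        Pi.smul_apply, tx, ty, Prod.snd_mul, Pi.mul_apply, Prod.pow_snd,
        Pi.pow_apply, ← map_pow, ← map_mul, ← mu_smul, ← map_sum, ex_inv, tab_mat]
      ext a b
      simp [mu, Matrix.single_apply]
    · simp [hl]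

lemma Phi_surj : Function.Surjective (Phi F) := by
  rw [← AlgHom.range_eq_top, eq_top_iff]
  rintro ⟨s, M⟩ -
  have h1 : ((s, 0) : T F) ∈ (Phi F).range := by
    induction s using MonoidAlgebra.induction_on with
    | of g =>
      have hg : ∃ b : ℕ, g = gy ^ b := by
        revert g; 
        have : ∀ g : C3, ∃ b : Fin 3, g = gy ^ (b : ℕ) := by decide +kernel
        intro g; obtain ⟨b, hb⟩ := this g; exact ⟨b, hb⟩
      obtain ⟨b, rfl⟩ := hg
      have := mul_mem (e0_mem F) (pow_mem (ty_mem F) b)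
      convert this using 1
      ext1
      · simp [ty]
      · simp
    | add a b ha hb => simpa using add_mem ha hb
    | smul r f h => simpa using Subalgebra.smul_mem _ h r
  have h2 : ∀ i, ((0, Pi.single i (M i)) : T F) ∈ (Phi F).range := by
    intro i
    have : ∑ j, ∑ k, M i j k • ((0, Pi.single i (Matrix.single j k 1)) : T F) ∈ (Phi F).range :=
      sum_mem fun j _ => sum_mem fun k _ => Subalgebra.smul_mem _ (single_mem F i j k) _
    convert this using 1
    ext1
    · simp [Prod.fst_sum]
    · funext l
      simp only [Prod.snd_sum, Finset.sum_apply, Prod.smul_snd, Pi.smul_apply]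
      by_cases hl : l = i
      · subst hl
        simp only [Pi.single_eq_same, Matrix.smul_single, smul_eq_mul, mul_one]
        exact Matrix.matrix_eq_sum_single (M l)
      · simp [hl]
  have h3 := add_mem h1 (sum_mem (t := Finset.univ) fun i _ => h2 i)
  convert h3 using 1
  ext1
  · simp [Prod.fst_sum]
  · simp [Prod.snd_sum, Finset.univ_sum_single]

lemma Phi_bij : Function.Bijective (Phi F) := by
  obtain ⟨hfin, hcard⟩ := card_le
  have hT : Module.finrank F (T F) = 39 := by
    have h3 : Module.finrank F (S F) = 3 := by
      rw [Module.finrank_eq_card_basis (MonoidAlgebra.basis C3 F)]; rfl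
    have : Module.Finite F (S F) := Module.Finite.of_basis (MonoidAlgebra.basis C3 F)
    rw [Module.finrank_prod, h3, Module.finrank_pi_fintype]
    simp [Module.finrank_matrix]
  have hA : Module.finrank F (MonoidAlgebra F (T3m 13 3)) ≤ 39 := by
    rw [Module.finrank_eq_nat_card_basis (MonoidAlgebra.basis (T3m 13 3) F)]
    exact hcard
  have : Module.Finite F (MonoidAlgebra F (T3m 13 3)) :=
    Module.Finite.of_basis (MonoidAlgebra.basis (T3m 13 3) F)
  have hle := LinearMap.finrank_le_finrank_of_surjective (f := (Phi F).toLinearMap) (Phi_surj F)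
  refine ⟨?_, Phi_surj F⟩
  exact (LinearMap.injective_iff_surjective_of_finrank_eq_finrank (f := (Phi F).toLinearMap)
    (by omega)).2 (Phi_surj F)

end main
end T39

/-- For `F = 𝔽_{3ⁿ}` and `G = T_{39} = ⟨x, y | x¹³ = y³ = 1, y⁻¹xy = x³⟩`, the unit group of
`FG` is isomorphic to `C₃^{2n} × C_{3ⁿ−1} × GL₃(F)⁴`. -/
theorem unit_group_T39 (n : ℕ) (hn : 0 < n) (F : Type*) [Field F] [Fintype F]
    (hF : Fintype.card F = 3 ^ n) :
    Nonempty ((MonoidAlgebra F (T3m 13 3))ˣ ≃*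
      (Fin (2 * n) → Multiplicative (ZMod 3)) × Multiplicative (ZMod (3 ^ n - 1)) ×
        (Fin 4 → GL (Fin 3) F)) := by
  have : Fact (Nat.Prime 3) := ⟨by norm_num⟩
  have : CharP F 3 := by
    obtain ⟨p, hp⟩ := CharP.exists F
    obtain ⟨m, hpp, hm⟩ := FiniteField.card F p
    rw [hF] at hm
    have : 3 ∣ p := Nat.prime_three.dvd_of_dvd_pow (hm ▸ dvd_pow_self 3 hn.ne')
    have : 3 = p := (Nat.prime_dvd_prime_iff_eq Nat.prime_three hpp).1 this
    subst this; exact hp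
  obtain ⟨eK⟩ := T39.ker_equiv F n hF
  have eF : Fˣ ≃* Multiplicative (ZMod (3 ^ n - 1)) := by
    refine mulEquivOfCyclicCardEq ?_
    rw [Nat.card_units, Nat.card_eq_fintype_card, hF]
    exact (Nat.card_zmod _).symm
  have e1 : (MonoidAlgebra F (T3m 13 3))ˣ ≃* (T39.T F)ˣ :=
    Units.mapEquiv (AlgEquiv.ofBijective (T39.Phi F) (T39.Phi_bij F)).toMulEquiv
  exact ⟨e1.trans <| MulEquiv.prodUnits.trans <|
    (MulEquiv.prodCongr ((T39.splitU F).symm.trans (eK.prodCongr eF)) MulEquiv.piUnits).trans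
      MulEquiv.prodAssoc⟩
end
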